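/- arXiv:2503.19778 — 2 statements merged into one kernel-verified Lean document; each statement's English description precedes it below -/
import Mathlib

section
/- Let G1 and G2 be finite groups with G1 abelian. If the strong independence complexes Σ̃(G1) and Σ̃(G2) are isomorphic, then the subgroup lattices of G1 and G2 are isomorphic as lattices. -/
/-- A subset `X` of a group is independent if no element of `X` lies in the
subgroup generated by the other elements of `X`. -/
def Independent {G : Type*} [Group G] (X : Set G) : Prop :=
  ∀ x ∈ X, x ∉ Subgroup.closure (X \ {x})

/-- `dgen H` is the least cardinality of a generating set of the subgroup `H`. -/
noncomputable def dgen {G : Type*} [Group G] (H : Subgroup G) : ℕ :=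
  sInf {n : ℕ | ∃ S : Set G, S.Finite ∧ S ⊆ (H : Set G) ∧ Subgroup.closure S = H ∧ S.ncard = n}

/-- A subset `X` of a group is strongly independent if every subgroup `H` containing `X`
satisfies `|X| ≤ d(H)`. -/
def StronglyIndependent {G : Type*} [Group G] (X : Set G) : Prop :=
  ∀ H : Subgroup G, X ⊆ (H : Set G) → X.ncard ≤ dgen H

/-- A group is hamiltonian if it is nonabelian and all of its subgroups are normal. -/
def IsHamiltonian (G : Type*) [Group G] : Prop :=
  (∃ a b : G, a * b ≠ b * a) ∧ ∀ H : Subgroup G, H.Normal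

open Subgroup

section CyclicSubgroups

variable {G : Type*} [Group G]

theorem mem_zpowers_of_orderOf_dvd [Finite G] {x y z : G} (hx : x ∈ zpowers z)
    (hy : y ∈ zpowers z) (h : orderOf y ∣ orderOf x) : y ∈ zpowers x := by
  classical
  rw [mem_zpowers_iff_mem_range_orderOf] at hx hy
  simp only [Finset.mem_image, Finset.mem_range] at hx hy
  obtain ⟨i, -, rfl⟩ := hx
  obtain ⟨j, -, rfl⟩ := hy
  have h1 : orderOf z ∣ j * orderOf (z ^ i) := by
    rw [orderOf_dvd_iff_pow_eq_one, pow_mul]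
    exact orderOf_dvd_iff_pow_eq_one.mp h
  have hpos : 0 < orderOf z := orderOf_pos z
  have hg : (orderOf z).gcd i ∣ j := by
    rw [orderOf_pow] at h1
    have hd : orderOf z / (orderOf z).gcd i * (orderOf z).gcd i = orderOf z :=
      Nat.div_mul_cancel (Nat.gcd_dvd_left _ _)
    have hq : 0 < orderOf z / (orderOf z).gcd i := by
      rcases Nat.eq_zero_or_pos (orderOf z / (orderOf z).gcd i) with h0 | h0
      · rw [h0] at hd; omega
      · exact h0
    refine Nat.dvd_of_mul_dvd_mul_left hq ?_
    rw [hd, mul_comm]; exact h1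
  obtain ⟨k, rfl⟩ := hg
  have hb := Nat.gcd_eq_gcd_ab (orderOf z) i
  have : z ^ (orderOf z).gcd i = (z ^ i) ^ (Nat.gcdB (orderOf z) i) := by
    rw [← zpow_natCast z ((orderOf z).gcd i), hb, zpow_add, zpow_mul, zpow_natCast,
      pow_orderOf_eq_one, one_zpow, one_mul, zpow_mul, zpow_natCast]
  rw [pow_mul, this]
  exact pow_mem (zpow_mem (mem_zpowers _) _) _

theorem exists_zpowers_eq_of_le [Finite G] {H : Subgroup G} {z : G} (h : H ≤ zpowers z) :
    ∃ w, H = zpowers w := by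
  have : IsCyclic H := by
    have := isCyclic_of_injective (inclusion h) (inclusion_injective h)
    exact this
  obtain ⟨w, hw⟩ := (Subgroup.isCyclic_iff_exists_zpowers_eq_top H).mp this
  exact ⟨w, hw.symm⟩

/-- An exponent projecting a finite group of order dividing `N` onto its `p`-elements. -/
theorem exists_primary_exponent (p N : ℕ) (hp : p.Prime) (hN : N ≠ 0) :
    ∃ m : ℕ, (∀ k, p ^ k ∣ N → m ≡ 1 [MOD p ^ k]) ∧ N ∣ m * p ^ N.factorization p ∧
      ∀ q, q.Prime → q ≠ p → ∀ k, q ^ k ∣ N → q ^ k ∣ m := by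
  have hcop : (ordProj[p] N).Coprime (ordCompl[p] N) :=
    (Nat.coprime_ordCompl hp hN).pow_left _
  obtain ⟨m, hm1, hm0⟩ := Nat.chineseRemainder hcop 1 0
  have hm0' : ordCompl[p] N ∣ m := (Nat.modEq_zero_iff_dvd).mp hm0
  refine ⟨m, fun k hk => hm1.of_dvd ?_, ?_, fun q hq hqp k hk => ?_⟩
  · exact pow_dvd_pow _ ((hp.pow_dvd_iff_le_factorization hN).mp hk)
  · calc N = ordCompl[p] N * ordProj[p] N := by rw [mul_comm, Nat.ordProj_mul_ordCompl_eq_self]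
      _ ∣ _ := Nat.mul_dvd_mul_right hm0' _
  · refine dvd_trans ?_ hm0'
    have : q ^ k ∣ ordProj[p] N * ordCompl[p] N := by
      rwa [Nat.ordProj_mul_ordCompl_eq_self]
    refine Nat.Coprime.dvd_of_dvd_mul_left ?_ this
    exact Nat.Coprime.pow _ _ ((Nat.coprime_primes hq hp).mpr hqp)

theorem not_dvd_of_modEq_one {p m : ℕ} (hp : p.Prime) (h : m ≡ 1 [MOD p]) : ¬ p ∣ m := fun hpm =>
  hp.one_lt.ne' (Nat.dvd_one.mp
    (Nat.modEq_zero_iff_dvd.mp (h.symm.trans (Nat.modEq_zero_iff_dvd.mpr hpm))))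

theorem card_zpowers_le_of_pow [Finite G] {x : G} {n : ℕ} (hn : 0 < n) (h : x ^ n = 1) :
    Nat.card (zpowers x) ≤ n := by
  rw [Nat.card_zpowers]
  exact Nat.le_of_dvd hn (orderOf_dvd_of_pow_eq_one h)

/-- An element all of whose primary parts lie in a subgroup lies in the subgroup. -/
theorem mem_of_forall_primary_mem {H : Subgroup G} {x : G} {N : ℕ} (hN : N ≠ 0)
    (hx : x ^ N = 1)
    (h : ∀ p, p.Prime → p ∣ N → ∃ m : ℕ, ¬ p ∣ m ∧ x ^ m ∈ H) : x ∈ H := by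
  have hgcd : ∀ a b : ℕ, x ^ a ∈ H → x ^ b ∈ H → x ^ (a.gcd b) ∈ H := by
    intro a b ha hb
    rw [← zpow_natCast, Nat.gcd_eq_gcd_ab, zpow_add, zpow_mul, zpow_mul, zpow_natCast,
      zpow_natCast]
    exact mul_mem (zpow_mem ha _) (zpow_mem hb _)
  have key : ∀ n : ℕ, n ≠ 0 → n ∣ N → x ^ n ∈ H → x ∈ H := by
    intro n
    induction n using Nat.strong_induction_on with
    | _ n ih =>
      intro hn hnN hxn
      by_cases h1 : n = 1
      · simpa [h1] using hxn
      obtain ⟨p, hp, hpn⟩ := Nat.exists_prime_and_dvd h1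
      obtain ⟨m, hpm, hm⟩ := h p hp (hpn.trans hnN)
      have hlt : n.gcd m < n := by
        refine lt_of_le_of_ne (Nat.gcd_le_left _ (Nat.pos_of_ne_zero hn)) fun he => hpm ?_
        exact hpn.trans (he ▸ Nat.gcd_dvd_right n m)
      exact ih _ hlt (Nat.gcd_ne_zero_left hn) ((Nat.gcd_dvd_left _ _).trans hnN)
        (hgcd _ _ hxn hm)
  exact key N hN dvd_rfl (hx ▸ one_mem H)

end CyclicSubgroups

section StrongIndependence

variable {G : Type*} [Group G]

/-- Two elements are cocyclic if they lie in a common cyclic subgroup. -/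
def Cocyclic (x y : G) : Prop := ∃ z : G, x ∈ zpowers z ∧ y ∈ zpowers z

theorem Cocyclic.symm {x y : G} (h : Cocyclic x y) : Cocyclic y x :=
  let ⟨z, hx, hy⟩ := h
  ⟨z, hy, hx⟩

theorem Cocyclic.refl (x : G) : Cocyclic x x := ⟨x, mem_zpowers x, mem_zpowers x⟩

theorem Cocyclic.mono {x x' y y' : G} (h : Cocyclic x y) (hx : x' ∈ zpowers x)
    (hy : y' ∈ zpowers y) : Cocyclic x' y' :=
  let ⟨z, h1, h2⟩ := h
  ⟨z, zpowers_le.mpr h1 hx, zpowers_le.mpr h2 hy⟩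

theorem Cocyclic.commute {x y : G} (h : Cocyclic x y) : Commute x y := by
  obtain ⟨z, ⟨i, rfl⟩, ⟨j, rfl⟩⟩ := h
  exact (Commute.refl z).zpow_zpow i j

theorem zpowers_sup_zpowers (u v : G) : zpowers u ⊔ zpowers v = closure {u, v} := by
  rw [zpowers_eq_closure, zpowers_eq_closure, ← Subgroup.closure_union,
    Set.singleton_union]

theorem dgen_le_ncard {S : Set G} (hS : S.Finite) : dgen (closure S) ≤ S.ncard :=
  Nat.sInf_le ⟨S, hS, subset_closure, rfl, rfl⟩

theorem exists_dgen [Finite G] (H : Subgroup G) :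
    ∃ S : Set G, closure S = H ∧ S.ncard = dgen H := by
  have hne : {n : ℕ | ∃ S : Set G, S.Finite ∧ S ⊆ (H : Set G) ∧ closure S = H ∧
      S.ncard = n}.Nonempty := ⟨_, H, Set.toFinite _, subset_rfl, closure_eq H, rfl⟩
  obtain ⟨S, -, -, h1, h2⟩ := Nat.sInf_mem hne
  exact ⟨S, h1, h2⟩

theorem dgen_zpowers_le (z : G) : dgen (zpowers z) ≤ 1 := by
  rw [zpowers_eq_closure]
  exact (dgen_le_ncard (Set.finite_singleton z)).trans (Set.ncard_singleton z).le

theorem dgen_zpowers_sup_le (u v : G) : dgen (zpowers u ⊔ zpowers v) ≤ 2 := by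
  rw [zpowers_sup_zpowers]
  exact (dgen_le_ncard (Set.toFinite {u, v})).trans
    ((Set.ncard_insert_le u {v}).trans (by rw [Set.ncard_singleton]))

theorem exists_eq_zpowers_of_dgen_le_one [Finite G] {H : Subgroup G} (h : dgen H ≤ 1) :
    ∃ z, H = zpowers z := by
  obtain ⟨S, rfl, hS⟩ := exists_dgen H
  rw [← hS, Set.ncard_le_one_iff_eq] at h
  rcases h with rfl | ⟨z, rfl⟩
  · exact ⟨1, by simp⟩
  · exact ⟨z, by rw [zpowers_eq_closure]⟩

theorem exists_eq_sup_zpowers_of_dgen_le_two [Finite G] {H : Subgroup G} (h : dgen H ≤ 2) :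
    ∃ u v, H = zpowers u ⊔ zpowers v := by
  rcases Nat.lt_or_ge 1 (dgen H) with h1 | h1
  · obtain ⟨S, rfl, hS⟩ := exists_dgen H
    obtain ⟨u, v, -, rfl⟩ := Set.ncard_eq_two.mp (hS.trans (le_antisymm h h1))
    exact ⟨u, v, (zpowers_sup_zpowers u v).symm⟩
  · obtain ⟨z, rfl⟩ := exists_eq_zpowers_of_dgen_le_one h1
    exact ⟨z, z, (sup_idem _).symm⟩

theorem stronglyIndependent_pair_iff [Finite G] {x y : G} (h : x ≠ y) :
    StronglyIndependent {x, y} ↔ ¬ Cocyclic x y := by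
  unfold StronglyIndependent
  rw [Set.ncard_pair h]
  constructor
  · rintro hS ⟨z, hx, hy⟩
    have := hS (zpowers z) (by rintro t (rfl | rfl) <;> assumption)
    have := dgen_zpowers_le z
    omega
  · intro hn H hH
    by_contra! hlt
    obtain ⟨z, rfl⟩ := exists_eq_zpowers_of_dgen_le_one (Nat.le_of_lt_succ hlt)
    exact hn ⟨z, hH (by simp), hH (by simp)⟩

/-- Three elements are jointly two-generated if they lie in a common two-generated subgroup. -/
def JointlyTwoGenerated (x y z : G) : Prop :=
  ∃ u v : G, x ∈ zpowers u ⊔ zpowers v ∧ y ∈ zpowers u ⊔ zpowers v ∧ z ∈ zpowers u ⊔ zpowers v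

theorem stronglyIndependent_triple_iff [Finite G] {x y z : G} (hxy : x ≠ y) (hxz : x ≠ z)
    (hyz : y ≠ z) : StronglyIndependent {x, y, z} ↔ ¬ JointlyTwoGenerated x y z := by
  have hcard : ({x, y, z} : Set G).ncard = 3 := Set.ncard_eq_three.mpr ⟨x, y, z, hxy, hxz, hyz, rfl⟩
  unfold StronglyIndependent
  rw [hcard]
  constructor
  · rintro hS ⟨u, v, hx, hy, hz⟩
    have := hS (zpowers u ⊔ zpowers v) (by rintro t (rfl | rfl | rfl) <;> assumption)
    have := dgen_zpowers_sup_le u v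
    omega
  · intro hn H hH
    by_contra! hlt
    obtain ⟨u, v, rfl⟩ := exists_eq_sup_zpowers_of_dgen_le_two (Nat.le_of_lt_succ hlt)
    exact hn ⟨u, v, hH (by simp), hH (by simp), hH (by simp)⟩

theorem mem_sup_zpowers_left (u v : G) : u ∈ zpowers u ⊔ zpowers v :=
  le_sup_left (a := zpowers u) (mem_zpowers u)

theorem mem_sup_zpowers_right (u v : G) : v ∈ zpowers u ⊔ zpowers v :=
  le_sup_right (a := zpowers u) (mem_zpowers v)

variable {G' : Type*} [Group G'] [Finite G] [Finite G']

theorem cocyclic_iff_of_iso (φ : G ≃ G')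
    (hφ : ∀ X : Set G, StronglyIndependent X ↔ StronglyIndependent (φ '' X)) (x y : G) :
    Cocyclic (φ x) (φ y) ↔ Cocyclic x y := by
  by_cases h : x = y
  · subst h; exact ⟨fun _ => .refl _, fun _ => .refl _⟩
  · have := hφ {x, y}
    rw [Set.image_pair, stronglyIndependent_pair_iff h,
      stronglyIndependent_pair_iff (φ.injective.ne h)] at this
    tauto

theorem jointlyTwoGenerated_of_iso (φ : G ≃ G')
    (hφ : ∀ X : Set G, StronglyIndependent X ↔ StronglyIndependent (φ '' X)) {x y z : G}
    (h : JointlyTwoGenerated (φ x) (φ y) (φ z)) : JointlyTwoGenerated x y z := by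
  have two (a b : G) : a ∈ zpowers a ⊔ zpowers b ∧ b ∈ zpowers a ⊔ zpowers b :=
    ⟨mem_sup_zpowers_left a b, mem_sup_zpowers_right a b⟩
  by_cases hxy : x = y
  · subst hxy; exact ⟨x, z, (two x z).1, (two x z).1, (two x z).2⟩
  by_cases hxz : x = z
  · subst hxz; exact ⟨x, y, (two x y).1, (two x y).2, (two x y).1⟩
  by_cases hyz : y = z
  · subst hyz; exact ⟨x, y, (two x y).1, (two x y).2, (two x y).2⟩
  have := hφ {x, y, z}
  rw [Set.image_insert_eq, Set.image_pair, stronglyIndependent_triple_iff hxy hxz hyz,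
    stronglyIndependent_triple_iff (φ.injective.ne hxy) (φ.injective.ne hxz)
      (φ.injective.ne hyz)] at this
  tauto

end StrongIndependence

section CyclicCorrespondence

theorem zpowers_eq_of_mem_of_orderOf_eq {G : Type*} [Group G] [Finite G] {x y : G}
    (h : x ∈ zpowers y) (ho : orderOf x = orderOf y) : zpowers x = zpowers y :=
  le_antisymm (zpowers_le.mpr h)
    (zpowers_le.mpr (mem_zpowers_of_orderOf_dvd h (mem_zpowers y) (dvd_of_eq ho.symm)))

theorem orderOf_eq_of_zpowers_eq {G : Type*} [Group G] {x y : G}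
    (h : zpowers x = zpowers y) : orderOf x = orderOf y := by
  rw [← Nat.card_zpowers, h, Nat.card_zpowers]

variable {A B : Type*} [Group A] [Group B]

/-- A map inducing an order preserving isomorphism between the posets of cyclic subgroups, such
that elements whose images generate a two-generated subgroup are jointly two-generated. -/
structure CyclicCorrespondence (e : A → B) : Prop where
  orderOf_eq : ∀ x, orderOf (e x) = orderOf x
  mem_zpowers_iff : ∀ x y, e y ∈ zpowers (e x) ↔ y ∈ zpowers x
  exists_zpowers_eq : ∀ b, ∃ a, zpowers (e a) = zpowers b
  jointlyTwoGenerated : ∀ a b c, e c ∈ zpowers (e a) ⊔ zpowers (e b) → JointlyTwoGenerated a b c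

theorem CyclicCorrespondence.zpowers_eq_iff {e : A → B} (h : CyclicCorrespondence e) (x y : A) :
    zpowers (e x) = zpowers (e y) ↔ zpowers x = zpowers y := by
  simp only [le_antisymm_iff, zpowers_le, h.mem_zpowers_iff]

theorem exists_mulEquiv_zpowers {x : A} {y : B} (h : orderOf x = orderOf y) :
    Nonempty (zpowers x ≃* zpowers y) :=
  ⟨mulEquivOfCyclicCardEq (by rw [Nat.card_zpowers, Nat.card_zpowers, h])⟩

theorem CyclicCorrespondence.congr {e f : A → B} (h : CyclicCorrespondence e)
    (hf : ∀ x, zpowers (f x) = zpowers (e x)) : CyclicCorrespondence f where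
  orderOf_eq x := (orderOf_eq_of_zpowers_eq (hf x)).trans (h.orderOf_eq x)
  mem_zpowers_iff x y := by
    rw [← h.mem_zpowers_iff, ← zpowers_le, hf, hf, zpowers_le]
  exists_zpowers_eq b := by simpa only [hf] using h.exists_zpowers_eq b
  jointlyTwoGenerated a b c hc := by
    refine h.jointlyTwoGenerated a b c ?_
    rwa [← zpowers_le, hf, hf, hf, zpowers_le] at hc

variable [Finite A] [Finite B]

theorem exists_equiv_generators {x : A} {y : B} (h : orderOf x = orderOf y) :
    Nonempty ({a : A // zpowers a = zpowers x} ≃ {b : B // zpowers b = zpowers y}) := by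
  obtain ⟨τ⟩ := exists_mulEquiv_zpowers h
  refine ⟨⟨fun a => ⟨τ ⟨a, a.2.le (mem_zpowers a.1)⟩, ?_⟩,
    fun b => ⟨τ.symm ⟨b, b.2.le (mem_zpowers b.1)⟩, ?_⟩, fun a => ?_, fun b => ?_⟩⟩
  · refine zpowers_eq_of_mem_of_orderOf_eq (SetLike.coe_mem _) ?_
    rw [Subgroup.orderOf_coe, MulEquiv.orderOf_eq, Subgroup.orderOf_mk, ← h]
    exact orderOf_eq_of_zpowers_eq a.2
  · refine zpowers_eq_of_mem_of_orderOf_eq (SetLike.coe_mem _) ?_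
    rw [Subgroup.orderOf_coe, MulEquiv.orderOf_eq, Subgroup.orderOf_mk, h]
    exact orderOf_eq_of_zpowers_eq b.2
  · simp
  · simp

theorem CyclicCorrespondence.exists_equiv {e : A → B} (h : CyclicCorrespondence e) :
    ∃ F : A ≃ B, ∀ x, zpowers (F x) = zpowers (e x) := by
  have fiber (c : Subgroup B) :
      Nonempty ({a : A // zpowers (e a) = c} ≃ {b : B // zpowers b = c}) := by
    by_cases hc : ∃ a, zpowers (e a) = c
    · obtain ⟨a, rfl⟩ := hc
      simp only [h.zpowers_eq_iff]
      exact exists_equiv_generators (h.orderOf_eq a).symm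
    · have h1 : IsEmpty {a : A // zpowers (e a) = c} := ⟨fun a => hc ⟨a, a.2⟩⟩
      have h2 : IsEmpty {b : B // zpowers b = c} := ⟨fun b => hc <| by
        obtain ⟨a, ha⟩ := h.exists_zpowers_eq b
        exact ⟨a, ha.trans b.2⟩⟩
      exact ⟨Equiv.equivOfIsEmpty _ _⟩
  exact ⟨Equiv.ofFiberEquiv (f := fun a => zpowers (e a)) (g := fun b : B => zpowers b)
    fun c => (fiber c).some, fun x => Equiv.ofFiberEquiv_map _ x⟩

theorem CyclicCorrespondence.zpowers_map_pow {e : A → B} (h : CyclicCorrespondence e) (x : A)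
    (n : ℕ) : zpowers (e (x ^ n)) = zpowers (e x ^ n) := by
  have h1 : e (x ^ n) ∈ zpowers (e x) := (h.mem_zpowers_iff _ _).mpr (pow_mem (mem_zpowers x) n)
  have h2 : orderOf (e (x ^ n)) = orderOf (e x ^ n) := by
    rw [h.orderOf_eq, orderOf_pow, orderOf_pow, h.orderOf_eq]
  exact zpowers_eq_of_mem_of_orderOf_eq (mem_zpowers_of_orderOf_dvd
    (pow_mem (mem_zpowers _) n) h1 (dvd_of_eq h2)) h2

end CyclicCorrespondence

theorem card_map_mul_card_inf_ker {G G' : Type*} [Group G] [Group G'] (f : G →* G')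
    (K : Subgroup G) : Nat.card (K.map f) * Nat.card (K ⊓ f.ker : Subgroup G) = Nat.card K := by
  rw [← relIndex_ker, ← inf_relIndex_left, ← relIndex_bot_left (K ⊓ f.ker), mul_comm,
    relIndex_mul_relIndex _ _ _ bot_le inf_le_left, relIndex_bot_left]

theorem exists_zpow_mul_zpow_of_commute {G : Type*} [Group G] {a b k : G} (h : Commute a b)
    (hk : k ∈ zpowers a ⊔ zpowers b) : ∃ i j : ℤ, k = a ^ i * b ^ j := by
  have hc : ∀ m n, Commute (zpowersHom G a m) (zpowersHom G b n) := fun m n => by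
    rw [zpowersHom_apply, zpowersHom_apply]; exact h.zpow_zpow _ _
  have hr : zpowers a ⊔ zpowers b =
      ((zpowersHom G a).noncommCoprod (zpowersHom G b) hc).range := by
    rw [MonoidHom.noncommCoprod_range]
    congr 1
  rw [hr] at hk
  obtain ⟨⟨i, j⟩, rfl⟩ := hk
  exact ⟨i.toAdd, j.toAdd, by simp⟩

section Torsion

variable {p : ℕ} {G : Type*} [Group G]

theorem mk_mem_zpowers_mk_iff {N : Subgroup G} [N.Normal] {x y : G} :
    (y : G ⧸ N) ∈ zpowers (x : G ⧸ N) ↔ ∃ w ∈ N, ∃ k : ℤ, y = x ^ k * w := by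
  constructor
  · intro h
    obtain ⟨k, hk⟩ := mem_zpowers_iff.mp h
    rw [← QuotientGroup.mk_zpow, QuotientGroup.eq] at hk
    exact ⟨_, hk, k, by group⟩
  · rintro ⟨w, hw, k, rfl⟩
    rw [QuotientGroup.mk_mul, (QuotientGroup.eq_one_iff w).mpr hw, mul_one, QuotientGroup.mk_zpow]
    exact zpow_mem (mem_zpowers _) k

theorem card_comap_mk (N : Subgroup G) [N.Normal] (L : Subgroup (G ⧸ N)) :
    Nat.card (L.comap (QuotientGroup.mk' N)) = Nat.card L * Nat.card N := by
  rw [← card_map_mul_card_inf_ker (QuotientGroup.mk' N),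
    map_comap_eq_self_of_surjective (QuotientGroup.mk'_surjective N), QuotientGroup.ker_mk',
    inf_eq_right.mpr]
  exact (QuotientGroup.le_comap_mk' N L)

theorem orderOf_mk_eq_orderOf_pow {W : Subgroup G} [W.Normal] (hW : ∀ x, x ∈ W ↔ x ^ p = 1)
    (x : G) : orderOf (x : G ⧸ W) = orderOf (x ^ p) := by
  rw [orderOf_eq_orderOf_iff]
  intro n
  rw [← QuotientGroup.mk_pow, QuotientGroup.eq_one_iff, hW, pow_right_comm]

theorem exists_torsion_subgroup
    (hcomm : ∀ a b : G, a ^ p = 1 → b ^ p = 1 → Commute a b) :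
    ∃ W : Subgroup G, W.Normal ∧ ∀ x, x ∈ W ↔ x ^ p = 1 :=
  ⟨{ carrier := {x | x ^ p = 1}
     one_mem' := one_pow p
     mul_mem' := fun {a b} ha hb => by
       rw [Set.mem_ofPred_eq] at ha hb ⊢
       rw [(hcomm a b ha hb).mul_pow, ha, hb, one_mul]
     inv_mem' := fun {a} ha => by
       rw [Set.mem_ofPred_eq] at ha ⊢
       rw [inv_pow, ha, inv_one] },
    ⟨fun n hn g => by
      change (g * n * g⁻¹) ^ p = 1
      change n ^ p = 1 at hn
      rw [conj_pow, hn, mul_one, mul_inv_cancel]⟩, fun _ => Iff.rfl⟩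

theorem exists_eq_zpow_mul_of_pow_mem {A : Type*} [CommGroup A] {p : ℕ} {x y : A}
    (h : x ^ p ∈ zpowers (y ^ p)) :
    ∃ w ∈ (powMonoidHom p : A →* A).ker, ∃ k : ℤ, x = y ^ k * w := by
  obtain ⟨k, hk⟩ := mem_zpowers_iff.mp h
  refine ⟨(y ^ k)⁻¹ * x, ?_, k, by rw [mul_inv_cancel_left]⟩
  rw [MonoidHom.mem_ker, powMonoidHom_apply, mul_pow, ← hk, inv_pow, ← zpow_natCast,
    ← zpow_natCast y, zpow_comm, inv_mul_cancel]

end Torsion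

theorem CyclicCorrespondence.pow_eq_one_iff {A G : Type*} [Group A] [Group G] {F : A ≃ G}
    (hF : CyclicCorrespondence F) (x : A) (n : ℕ) : F x ^ n = 1 ↔ x ^ n = 1 := by
  rw [← orderOf_dvd_iff_pow_eq_one, hF.orderOf_eq, orderOf_dvd_iff_pow_eq_one]

theorem CyclicCorrespondence.isPGroup {A G : Type*} [Group A] [Group G] {F : A ≃ G}
    (hF : CyclicCorrespondence F) {p : ℕ} (hA : IsPGroup p A) : IsPGroup p G := fun g => by
  obtain ⟨a, rfl⟩ := F.surjective g
  obtain ⟨k, hk⟩ := hA a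
  exact ⟨k, (hF.pow_eq_one_iff a _).mpr hk⟩

theorem CyclicCorrespondence.card_torsion_eq {A G : Type*} [CommGroup A] [Group G] {F : A ≃ G}
    (hF : CyclicCorrespondence F) {p : ℕ} {W : Subgroup G} (hW : ∀ x, x ∈ W ↔ x ^ p = 1) :
    Nat.card (powMonoidHom p : A →* A).ker = Nat.card W :=
  Nat.card_congr (F.subtypeEquiv fun a => by
    rw [hW, hF.pow_eq_one_iff]
    exact Iff.rfl)

section PGroup

variable {p : ℕ} [Fact p.Prime] {G : Type*} [Group G]

theorem mem_zpowers_of_pow_eq_of_not_dvd {x y : G} {k n : ℕ} {m : ℤ}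
    (hk : y ^ p ^ k = 1) (h : x ^ n = y ^ m) (hm : ¬ (p : ℤ) ∣ m) : y ∈ zpowers x := by
  have hp : p.Prime := Fact.out
  have hc : IsCoprime m (p ^ k : ℕ) := by
    push_cast
    exact ((Nat.prime_iff_prime_int.mp hp).coprime_iff_not_dvd.mpr hm).symm.pow_right
  obtain ⟨a, b, hab⟩ := hc
  refine mem_zpowers_iff.mpr ⟨n * a, ?_⟩
  rw [zpow_mul, zpow_natCast, h, ← zpow_mul]
  have : m * a = 1 - b * (p ^ k : ℕ) := by linarith
  rw [this, zpow_sub, zpow_one, mul_comm, zpow_mul, zpow_natCast, hk,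
    one_zpow, inv_one, mul_one]

theorem exists_mem_sup_notMem_zpowers {W : Subgroup G} {x y : G} {i j : ℕ} (hx : x ^ p ^ i = 1)
    (hy : y ^ p ^ j = 1)
    (hroot : ∀ k, (x ^ p ^ k) ^ p ∈ zpowers (y ^ p) → ∃ w ∈ W, ∃ l : ℤ, x ^ p ^ k = y ^ l * w)
    (hxy : x ∉ zpowers y) (hyx : y ∉ zpowers x) :
    ∃ w ∈ zpowers x ⊔ zpowers y, w ∈ W ∧ w ∉ zpowers y := by
  have hxK := mem_sup_zpowers_left x y
  have hyK := mem_sup_zpowers_right x y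
  have hex : ∃ k, x ^ p ^ k ∈ zpowers y := ⟨i, hx ▸ one_mem _⟩
  classical
  obtain ⟨k, hk, hmin⟩ : ∃ k, x ^ p ^ k ∈ zpowers y ∧ ∀ j < k, x ^ p ^ j ∉ zpowers y :=
    ⟨Nat.find hex, Nat.find_spec hex, fun j hj => Nat.find_min hex hj⟩
  obtain _ | k := k
  · simp only [pow_zero, pow_one] at hk; exact absurd hk hxy
  have hk' := hmin k (Nat.lt_succ_self k)
  rw [pow_succ, pow_mul] at hk
  obtain ⟨m, hm⟩ := mem_zpowers_iff.mp hk
  have hpm : (p : ℤ) ∣ m := by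
    by_contra hpm
    rw [← pow_mul] at hm
    exact hyx (mem_zpowers_of_pow_eq_of_not_dvd hy hm.symm hpm)
  obtain ⟨n, rfl⟩ := hpm
  obtain ⟨w, hw, j, hj⟩ := hroot k
    (mem_zpowers_iff.mpr ⟨n, by rw [← hm, zpow_mul, zpow_natCast]⟩)
  have hw' : w = (y ^ j)⁻¹ * x ^ p ^ k := by rw [hj, inv_mul_cancel_left]
  refine ⟨w, ?_, hw, fun hwy => hk' ?_⟩
  · rw [hw']
    exact mul_mem (inv_mem (zpow_mem hyK _)) (pow_mem hxK _)
  · rw [hj]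
    exact mul_mem (zpow_mem (mem_zpowers y) _) hwy

variable [Finite G]

theorem card_le_of_le_zpowers {H : Subgroup G} {z : G} (h : H ≤ zpowers z)
    (hH : ∀ x ∈ H, x ^ p = 1) : Nat.card H ≤ p := by
  obtain ⟨w, rfl⟩ := exists_zpowers_eq_of_le h
  exact card_zpowers_le_of_pow (Fact.out : p.Prime).pos (hH w (mem_zpowers w))

theorem card_sup_zpowers_inf_ker_le {A : Type*} [CommGroup A] [Finite A] (u v : A) :
    Nat.card ((zpowers u ⊔ zpowers v) ⊓ (powMonoidHom p).ker : Subgroup A) ≤ p ^ 2 := by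
  set T : Subgroup A := (zpowers u ⊔ zpowers v) ⊓ (powMonoidHom p).ker
  have hT : ∀ x ∈ T, x ^ p = 1 := fun x hx => hx.2
  rw [← card_map_mul_card_inf_ker (QuotientGroup.mk' (zpowers u)) T, sq, QuotientGroup.ker_mk']
  refine Nat.mul_le_mul (card_le_of_le_zpowers (z := (v : A ⧸ zpowers u)) ?_ ?_)
    (card_le_of_le_zpowers inf_le_right fun x hx => hT x hx.1)
  · refine (Subgroup.map_mono inf_le_left).trans ?_
    rw [Subgroup.map_sup, MonoidHom.map_zpowers, MonoidHom.map_zpowers]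
    refine sup_le ?_ le_rfl
    rw [zpowers_le, QuotientGroup.mk'_apply, (QuotientGroup.eq_one_iff u).mpr (mem_zpowers u)]
    exact one_mem _
  · rintro _ ⟨x, hx, rfl⟩
    rw [← map_pow, hT x hx, map_one]

theorem sq_le_card_of_lt (hG : IsPGroup p G) {L K : Subgroup G} (hL : L ≠ ⊥) (h : L < K) :
    p ^ 2 ≤ Nat.card K := by
  have hp : p.Prime := Fact.out
  obtain ⟨k, hk⟩ := IsPGroup.iff_card.mp (hG.to_subgroup K)
  obtain ⟨l, hl⟩ := IsPGroup.iff_card.mp (hG.to_subgroup L)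
  have h1 : 1 < Nat.card L := (Subgroup.one_lt_card_iff_ne_bot L).mpr hL
  have h2 : Nat.card L < Nat.card K :=
    lt_of_le_of_ne (Subgroup.card_le_of_le h.le) fun he =>
      h.ne (Subgroup.eq_of_le_of_card_ge h.le he.ge)
  have hl0 : l ≠ 0 := by rintro rfl; simp [hl] at h1
  rw [hk, hl, Nat.pow_lt_pow_iff_right hp.one_lt] at h2
  rw [hk]
  exact Nat.pow_le_pow_right hp.pos (by omega)

theorem exists_pow_eq_one_mem_zpowers (hG : IsPGroup p G) {y : G} (hy : y ≠ 1) :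
    ∃ z ∈ zpowers y, orderOf z = p := by
  have hp : p.Prime := Fact.out
  have : p ∣ Nat.card (zpowers y) := by
    rw [Nat.card_zpowers]
    obtain ⟨k, hk⟩ := hG.exists_orderOf_eq_pow y
    rw [hk]
    refine dvd_pow_self p fun h0 => hy ?_
    rw [h0, pow_zero, orderOf_eq_one_iff] at hk
    exact hk
  obtain ⟨z, hz⟩ := exists_prime_orderOf_dvd_card' p this
  exact ⟨z, z.2, by rw [Subgroup.orderOf_coe, hz]⟩

theorem sq_le_card_inf (hG : IsPGroup p G) {W : Subgroup G} (hW : ∀ x, x ∈ W ↔ x ^ p = 1)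
    (hroot : ∀ x y : G, x ^ p ∈ zpowers (y ^ p) → ∃ w ∈ W, ∃ k : ℤ, x = y ^ k * w)
    {x y : G} (hxy : x ∉ zpowers y) (hyx : y ∉ zpowers x) :
    p ^ 2 ≤ Nat.card ((zpowers x ⊔ zpowers y) ⊓ W : Subgroup G) := by
  have hy1 : y ≠ 1 := by rintro rfl; exact hyx (one_mem _)
  obtain ⟨w, hwK, hwW, hwy⟩ := exists_mem_sup_notMem_zpowers (hG x).choose_spec
    (hG y).choose_spec (fun _ => hroot _ _) hxy hyx
  obtain ⟨z, hzy, hz⟩ := exists_pow_eq_one_mem_zpowers hG hy1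
  have hzp : z ^ p = 1 := hz ▸ pow_orderOf_eq_one z
  refine sq_le_card_of_lt hG (L := zpowers y ⊓ W) ?_
    (lt_of_le_of_ne (inf_le_inf_right _ le_sup_right) fun he => hwy ?_)
  · intro h
    have : z ∈ zpowers y ⊓ W := ⟨hzy, (hW z).mpr hzp⟩
    rw [h, mem_bot] at this
    rw [this, orderOf_one] at hz
    exact (Fact.out : p.Prime).one_lt.ne hz
  · have : w ∈ zpowers y ⊓ W := he ▸ ⟨hwK, hwW⟩
    exact this.1

theorem commute_of_pow_eq_one (hG : IsPGroup p G)
    (hcard : ∀ x y : G, x ∉ zpowers y → y ∉ zpowers x →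
      {k | k ∈ zpowers x ⊔ zpowers y ∧ k ^ p = 1}.ncard ≤ p ^ 2)
    {a b : G} (ha : a ^ p = 1) (hb : b ^ p = 1) : Commute a b := by
  have hp : p.Prime := Fact.out
  by_cases hab : a ∈ zpowers b
  · exact (Cocyclic.commute ⟨b, hab, mem_zpowers b⟩)
  by_cases hba : b ∈ zpowers a
  · exact (Cocyclic.commute ⟨a, mem_zpowers a, hba⟩)
  have ha1 : a ≠ 1 := by rintro rfl; exact hab (one_mem _)
  have hoa : orderOf a = p := orderOf_eq_prime ha ha1
  set V := zpowers a ⊔ zpowers b with hV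
  have haV : a ∈ V := mem_sup_zpowers_left a b
  have hbV : b ∈ V := mem_sup_zpowers_right a b
  have : Nontrivial V := ⟨⟨⟨a, haV⟩, 1, fun h => ha1 (congrArg Subtype.val h)⟩⟩
  have := (hG.to_subgroup V).center_nontrivial
  obtain ⟨z₁, hz₁⟩ := exists_ne (1 : center V)
  obtain ⟨z, hzV, hzc, hz⟩ : ∃ z ∈ V, (∀ v ∈ V, Commute v z) ∧ orderOf z = p := by
    obtain ⟨z, hz, ho⟩ := exists_pow_eq_one_mem_zpowers ((hG.to_subgroup V).to_subgroup (center V))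
      hz₁
    refine ⟨z, z.1.2, fun v hv => ?_, by rw [Subgroup.orderOf_coe, Subgroup.orderOf_coe, ho]⟩
    exact congrArg Subtype.val (mem_center_iff.mp z.2 ⟨v, hv⟩)
  have hzp : z ^ p = 1 := hz ▸ pow_orderOf_eq_one z
  by_cases haz : a ∈ zpowers z
  · obtain ⟨i, rfl⟩ := haz
    exact ((hzc b hbV).zpow_right i).symm
  have hle : zpowers a ⊔ zpowers z ≤ V := sup_le le_sup_left (zpowers_le.mpr hzV)
  have hzaz := mem_sup_zpowers_right a z
  have haaz := mem_sup_zpowers_left a z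
  have hbig : p ^ 2 ≤ Nat.card (zpowers a ⊔ zpowers z : Subgroup G) := by
    refine sq_le_card_of_lt hG (L := zpowers z) ?_
      (lt_of_le_of_ne le_sup_right fun he => haz (he ▸ haaz))
    rw [Ne, zpowers_eq_bot]
    rintro rfl
    exact hp.one_lt.ne (orderOf_one.symm.trans hz)
  have hsub : ((zpowers a ⊔ zpowers z : Subgroup G) : Set G) ⊆ {k | k ∈ V ∧ k ^ p = 1} := by
    intro k hk
    refine ⟨hle hk, ?_⟩
    obtain ⟨i, j, rfl⟩ := exists_zpow_mul_zpow_of_commute (hzc a haV) hk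
    rw [((hzc a haV).zpow_zpow i j).mul_pow, ← zpow_natCast, ← zpow_natCast, zpow_comm a,
      zpow_comm z, zpow_natCast, zpow_natCast, ha, hzp, one_zpow, one_zpow, one_mul]
  have heq := Set.eq_of_subset_of_ncard_le hsub
    ((hcard a b hab hba).trans (by rwa [← Nat.card_coe_set_eq] )) (Set.toFinite _)
  have hbz : b ∈ zpowers a ⊔ zpowers z := by
    have : b ∈ {k | k ∈ V ∧ k ^ p = 1} := ⟨hbV, hb⟩
    rwa [← heq] at this
  obtain ⟨i, j, rfl⟩ := exists_zpow_mul_zpow_of_commute (hzc a haV) hbz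
  exact ((Commute.refl a).zpow_right i).mul_right ((hzc a haV).zpow_right j)

theorem pow_mul_mem_zpowers_pow (hG : IsPGroup p G)
    (hcard : ∀ x y : G, x ∉ zpowers y → y ∉ zpowers x →
      {k | k ∈ zpowers x ⊔ zpowers y ∧ k ^ p = 1}.ncard ≤ p ^ 2)
    {W : Subgroup G} [W.Normal] (hW : ∀ x, x ∈ W ↔ x ^ p = 1) (x : G) {w : G} (hw : w ∈ W) :
    (x * w) ^ p ∈ zpowers (x ^ p) := by
  have hp : p.Prime := Fact.out
  by_cases hxW : x ∈ W
  · rw [(hW _).mp (mul_mem hxW hw)]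
    exact one_mem _
  by_cases hwx : w ∈ zpowers x
  · obtain ⟨i, rfl⟩ := hwx
    rw [((Commute.refl x).zpow_right i).mul_pow, (hW _).mp hw, mul_one]
    exact mem_zpowers _
  have hxw : x ∉ zpowers w := fun h => hxW (zpowers_le.mpr hw h)
  have hx1 : x ≠ 1 := by rintro rfl; exact hxW (one_mem _)
  set K := zpowers x ⊔ zpowers w with hK
  have hxK : x ∈ K := mem_sup_zpowers_left x w
  have hwK : w ∈ K := mem_sup_zpowers_right x w
  have hxKle : zpowers x ≤ K := le_sup_left
  have hindex : (zpowers x).relIndex K ≤ p := by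
    have h1 : W.relIndex K = W.relIndex (zpowers x) := by
      rw [← relIndex_sup_right (H := K), ← relIndex_sup_right (H := zpowers x), hK, sup_assoc,
        sup_eq_right.mpr (zpowers_le.mpr hw)]
    have h2 : Nat.card (W ⊓ K : Subgroup G) ≤ p ^ 2 := by
      rw [← SetLike.coe_sort_coe, Nat.card_coe_set_eq]
      convert hcard x w hxw hwx using 2
      ext k
      rw [SetLike.mem_coe, mem_inf, hW, and_comm]
      rfl
    have h3 : p ≤ Nat.card (W ⊓ zpowers x : Subgroup G) := by
      obtain ⟨z, hz, ho⟩ := exists_pow_eq_one_mem_zpowers hG hx1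
      rw [← ho, ← Nat.card_zpowers]
      exact card_le_of_le (zpowers_le.mpr ⟨(hW z).mpr (ho ▸ pow_orderOf_eq_one z), hz⟩)
    have h4 (L : Subgroup G) : Nat.card (W ⊓ L : Subgroup G) * W.relIndex L = Nat.card L := by
      rw [← inf_relIndex_right, ← relIndex_bot_left (W ⊓ L),
        relIndex_mul_relIndex _ _ _ bot_le inf_le_right, relIndex_bot_left]
    have h5 : Nat.card (zpowers x) * (zpowers x).relIndex K = Nat.card K := by
      rw [← relIndex_bot_left (zpowers x), relIndex_mul_relIndex _ _ _ bot_le hxKle,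
        relIndex_bot_left]
    rw [← h4 K, ← h4 (zpowers x), h1, mul_right_comm] at h5
    have h6 : 0 < W.relIndex (zpowers x) := Nat.pos_of_ne_zero index_ne_zero_of_finite
    have h7 := Nat.eq_of_mul_eq_mul_right h6 h5
    have h8 : p * (zpowers x).relIndex K ≤ p * p := by
      rw [← sq]
      exact (Nat.mul_le_mul_right _ h3).trans (h7.le.trans h2)
    exact Nat.le_of_mul_le_mul_left h8 hp.pos
  have hindex' : ((zpowers x).subgroupOf K).index = p := by
    obtain ⟨k, hk⟩ := IsPGroup.iff_card.mp (hG.to_subgroup K)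
    have hdvd : ((zpowers x).subgroupOf K).index ∣ p ^ k := hk ▸ index_dvd_card _
    obtain ⟨l, -, hl⟩ := (Nat.dvd_prime_pow hp).mp hdvd
    have hl1 : l ≤ 1 := by
      rw [← Nat.pow_le_pow_iff_right hp.one_lt, pow_one, ← hl]
      exact hindex
    have hl0 : l ≠ 0 := by
      rintro rfl
      rw [pow_zero, index_eq_one, subgroupOf_eq_top] at hl
      exact hwx (hl hwK)
    rw [hl, le_antisymm hl1 (Nat.one_le_iff_ne_zero.mpr hl0), pow_one]
  have hnormal : ((zpowers x).subgroupOf K).Normal := by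
    refine normal_of_index_eq_minFac_card ?_
    obtain ⟨k, hk⟩ := IsPGroup.iff_card.mp (hG.to_subgroup K)
    have hk0 : k ≠ 0 := by
      rintro rfl
      have h1 := index_dvd_card ((zpowers x).subgroupOf K)
      rw [hindex', hk, pow_zero, Nat.dvd_one] at h1
      exact hp.ne_one h1
    rw [hindex', hk, hp.pow_minFac hk0]
  obtain ⟨m, hm⟩ : ∃ m : ℤ, x ^ m = (x * w) ^ p := by
    have := pow_index_mem ((zpowers x).subgroupOf K) ⟨x * w, mul_mem hxK hwK⟩
    rw [hindex', mem_subgroupOf] at this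
    exact mem_zpowers_iff.mp this
  by_cases hpm : (p : ℤ) ∣ m
  · obtain ⟨n, rfl⟩ := hpm
    exact mem_zpowers_iff.mpr ⟨n, by rw [← hm, zpow_mul, zpow_natCast]⟩
  · have h1 := mem_zpowers_of_pow_eq_of_not_dvd (hG x).choose_spec hm.symm hpm
    have h2 : w ∈ zpowers (x * w) := by
      have := mul_mem (inv_mem h1) (mem_zpowers (x * w))
      rwa [inv_mul_cancel_left] at this
    obtain ⟨z, hz, ho⟩ := exists_pow_eq_one_mem_zpowers hG hx1
    refine absurd (mem_zpowers_of_orderOf_dvd h1 h2 ?_) hwx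
    refine (orderOf_dvd_of_pow_eq_one ((hW w).mp hw)).trans ?_
    rw [← ho]
    exact orderOf_dvd_of_mem_zpowers hz

variable {A : Type*} [CommGroup A] [Finite A]

theorem inf_ker_eq_of_mem (hA : IsPGroup p A) {a b u v : A} (hab : a ∉ zpowers b)
    (hba : b ∉ zpowers a) (ha : a ∈ zpowers u ⊔ zpowers v) (hb : b ∈ zpowers u ⊔ zpowers v) :
    (zpowers a ⊔ zpowers b) ⊓ (powMonoidHom p).ker =
      (zpowers u ⊔ zpowers v) ⊓ (powMonoidHom p).ker :=
  eq_of_le_of_card_ge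
    (inf_le_inf_right _ (sup_le (zpowers_le.mpr ha) (zpowers_le.mpr hb)))
    ((card_sup_zpowers_inf_ker_le u v).trans (sq_le_card_inf hA (fun _ => MonoidHom.mem_ker)
      (fun _ _ h => exists_eq_zpow_mul_of_pow_mem h) hab hba))

namespace CyclicCorrespondence

variable {F : A ≃ G} (hF : CyclicCorrespondence F)
include hF

omit [Finite G] in
theorem mem_sup_of_pow_eq_one (hA : IsPGroup p A) {a b c : A} (hab : a ∉ zpowers b)
    (hba : b ∉ zpowers a) (hc : F c ∈ zpowers (F a) ⊔ zpowers (F b)) (hcp : c ^ p = 1) :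
    c ∈ zpowers a ⊔ zpowers b := by
  obtain ⟨u, v, ha, hb, hc'⟩ := hF.jointlyTwoGenerated a b c hc
  have h : c ∈ (zpowers u ⊔ zpowers v) ⊓ (powMonoidHom p).ker := ⟨hc', hcp⟩
  rw [← inf_ker_eq_of_mem hA hab hba ha hb] at h
  exact h.1

omit [Finite G] in
theorem ncard_pow_eq_one_le (hA : IsPGroup p A) (x y : G) (hxy : x ∉ zpowers y)
    (hyx : y ∉ zpowers x) : {k | k ∈ zpowers x ⊔ zpowers y ∧ k ^ p = 1}.ncard ≤ p ^ 2 := by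
  obtain ⟨a, rfl⟩ := F.surjective x
  obtain ⟨b, rfl⟩ := F.surjective y
  rw [hF.mem_zpowers_iff] at hxy hyx
  have hsub : {k | k ∈ zpowers (F a) ⊔ zpowers (F b) ∧ k ^ p = 1} ⊆
      F '' ((zpowers a ⊔ zpowers b) ⊓ (powMonoidHom p).ker : Subgroup A) := by
    rintro k ⟨hk, hkp⟩
    obtain ⟨c, rfl⟩ := F.surjective k
    rw [hF.pow_eq_one_iff] at hkp
    exact ⟨c, ⟨hF.mem_sup_of_pow_eq_one hA hxy hyx hk hkp, hkp⟩, rfl⟩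
  refine (Set.ncard_le_ncard hsub (Set.toFinite _)).trans ?_
  rw [Set.ncard_image_of_injective _ F.injective, ← Nat.card_coe_set_eq]
  exact card_sup_zpowers_inf_ker_le a b

theorem pow_mem_zpowers_pow_iff (x y : A) (n : ℕ) :
    F x ^ n ∈ zpowers (F y ^ n) ↔ x ^ n ∈ zpowers (y ^ n) := by
  rw [← zpowers_le, ← hF.zpowers_map_pow, ← hF.zpowers_map_pow, zpowers_le, hF.mem_zpowers_iff]

theorem mk_mem_zpowers_mk_iff (hA : IsPGroup p A) {W : Subgroup G} [W.Normal]
    (hW : ∀ x, x ∈ W ↔ x ^ p = 1) (x y : A) :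
    (F y : G ⧸ W) ∈ zpowers (F x : G ⧸ W) ↔
      (y : A ⧸ (powMonoidHom p : A →* A).ker) ∈ zpowers (x : A ⧸ (powMonoidHom p).ker) := by
  have himp (y : A) (h : (F y : G ⧸ W) ∈ zpowers (F x : G ⧸ W)) :
      (y : A ⧸ (powMonoidHom p : A →* A).ker) ∈ zpowers (x : A ⧸ (powMonoidHom p).ker) := by
    obtain ⟨w, hw, k, hk⟩ := _root_.mk_mem_zpowers_mk_iff.mp h
    refine _root_.mk_mem_zpowers_mk_iff.mpr (exists_eq_zpow_mul_of_pow_mem ?_)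
    rw [← hF.pow_mem_zpowers_pow_iff, hk]
    have h1 := pow_mul_mem_zpowers_pow (hF.isPGroup hA) (hF.ncard_pow_eq_one_le hA) hW (F x ^ k) hw
    refine zpowers_le.mpr ?_ h1
    have hcomm : (F x ^ k) ^ p = (F x ^ p) ^ k := by
      rw [← zpow_natCast, ← zpow_natCast, zpow_comm]
    rw [hcomm]
    exact zpow_mem (mem_zpowers _) k
  refine ⟨himp y, fun h => ?_⟩
  set SA := (zpowers (x : A ⧸ (powMonoidHom p : A →* A).ker)).comap (QuotientGroup.mk' _)
  set SB := (zpowers (F x : G ⧸ W)).comap (QuotientGroup.mk' W)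
  have hsub : (SB : Set G) ⊆ F '' SA := by
    intro z hz
    obtain ⟨y, rfl⟩ := F.surjective z
    exact ⟨y, himp y hz, rfl⟩
  have hcard : Nat.card SA = Nat.card SB := by
    rw [card_comap_mk, card_comap_mk, hF.card_torsion_eq hW, Nat.card_zpowers, Nat.card_zpowers,
      orderOf_mk_eq_orderOf_pow hW, orderOf_mk_eq_orderOf_pow (p := p) fun _ => MonoidHom.mem_ker]
    rw [← orderOf_eq_of_zpowers_eq (hF.zpowers_map_pow x p), hF.orderOf_eq]
  have heq := Set.eq_of_subset_of_ncard_le hsub (by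
    rw [Set.ncard_image_of_injective _ F.injective, ← Nat.card_coe_set_eq, ← Nat.card_coe_set_eq]
    exact hcard.le) (Set.toFinite _)
  have : F y ∈ F '' (SA : Set A) := ⟨y, h, rfl⟩
  rw [← heq] at this
  exact this

theorem exists_eq_zpow_mul_of_pow_mem (hA : IsPGroup p A) {W : Subgroup G} [W.Normal]
    (hW : ∀ x, x ∈ W ↔ x ^ p = 1) {x y : G} (h : x ^ p ∈ zpowers (y ^ p)) :
    ∃ w ∈ W, ∃ k : ℤ, x = y ^ k * w := by
  obtain ⟨a, rfl⟩ := F.surjective x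
  obtain ⟨b, rfl⟩ := F.surjective y
  rw [hF.pow_mem_zpowers_pow_iff] at h
  rw [← _root_.mk_mem_zpowers_mk_iff, hF.mk_mem_zpowers_mk_iff hA hW,
    _root_.mk_mem_zpowers_mk_iff]
  exact _root_.exists_eq_zpow_mul_of_pow_mem h

theorem quotient (hA : IsPGroup p A) {W : Subgroup G} [W.Normal]
    (hW : ∀ x, x ∈ W ↔ x ^ p = 1) :
    CyclicCorrespondence fun a : A ⧸ (powMonoidHom p : A →* A).ker => (F a.out : G ⧸ W) where
  orderOf_eq x := by
    conv_rhs => rw [← QuotientGroup.out_eq' x]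
    rw [orderOf_mk_eq_orderOf_pow hW, orderOf_mk_eq_orderOf_pow (p := p) fun _ => MonoidHom.mem_ker,
      ← orderOf_eq_of_zpowers_eq (hF.zpowers_map_pow _ p), hF.orderOf_eq]
  mem_zpowers_iff x y := by
    rw [hF.mk_mem_zpowers_mk_iff hA hW, QuotientGroup.out_eq', QuotientGroup.out_eq']
  exists_zpowers_eq b := by
    obtain ⟨b, rfl⟩ := QuotientGroup.mk_surjective b
    obtain ⟨a, rfl⟩ := F.surjective b
    refine ⟨a, ?_⟩
    refine le_antisymm ?_ ?_ <;>
      rw [zpowers_le, hF.mk_mem_zpowers_mk_iff hA hW, QuotientGroup.out_eq'] <;>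
      exact mem_zpowers _
  jointlyTwoGenerated a b c h := by
    obtain ⟨k, hk, hkc⟩ : ∃ k ∈ zpowers (F a.out) ⊔ zpowers (F b.out),
        QuotientGroup.mk' W k = (F c.out : G ⧸ W) := by
      rw [← Subgroup.mem_map, Subgroup.map_sup, MonoidHom.map_zpowers, MonoidHom.map_zpowers]
      exact h
    obtain ⟨c', rfl⟩ := F.surjective k
    have hcc : c ∈ zpowers (c' : A ⧸ (powMonoidHom p : A →* A).ker) := by
      rw [← QuotientGroup.out_eq' c, ← hF.mk_mem_zpowers_mk_iff hA hW, ← hkc]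
      exact mem_zpowers _
    obtain ⟨u, v, ha, hb, hc⟩ := hF.jointlyTwoGenerated _ _ _ hk
    have hmk (x : A) (hx : x ∈ zpowers u ⊔ zpowers v) :
        (x : A ⧸ (powMonoidHom p : A →* A).ker) ∈ zpowers (u : A ⧸ (powMonoidHom p : A →* A).ker) ⊔
          zpowers (v : A ⧸ (powMonoidHom p : A →* A).ker) := by
      have := Subgroup.mem_map_of_mem (QuotientGroup.mk' (powMonoidHom p : A →* A).ker) hx
      rwa [Subgroup.map_sup, MonoidHom.map_zpowers, MonoidHom.map_zpowers] at this
    refine ⟨u, v, ?_, ?_, zpowers_le.mpr (hmk _ hc) hcc⟩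
    · simpa only [QuotientGroup.out_eq'] using hmk _ ha
    · simpa only [QuotientGroup.out_eq'] using hmk _ hb

end CyclicCorrespondence

theorem CyclicCorrespondence.zpowers_mk_out_eq {F : A ≃ G} (hF : CyclicCorrespondence F)
    (hA : IsPGroup p A) {W : Subgroup G} [W.Normal] (hW : ∀ x, x ∈ W ↔ x ^ p = 1) (a : A) :
    zpowers (F (a : A ⧸ (powMonoidHom p : A →* A).ker).out : G ⧸ W) = zpowers (F a : G ⧸ W) := by
  refine le_antisymm ?_ ?_ <;>
    rw [zpowers_le, hF.mk_mem_zpowers_mk_iff hA hW, QuotientGroup.out_eq'] <;>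
    exact mem_zpowers _

theorem CyclicCorrespondence.mem_sup_iff_of_mk {F : A ≃ G} (hF : CyclicCorrespondence F)
    (hA : IsPGroup p A) {W : Subgroup G} [W.Normal] (hW : ∀ x, x ∈ W ↔ x ^ p = 1) {a b : A}
    (hab : a ∉ zpowers b) (hba : b ∉ zpowers a)
    (hmk : ∀ c, (F c : G ⧸ W) ∈ zpowers (F a : G ⧸ W) ⊔ zpowers (F b : G ⧸ W) ↔
      (c : A ⧸ (powMonoidHom p : A →* A).ker) ∈
        zpowers (a : A ⧸ (powMonoidHom p : A →* A).ker) ⊔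
          zpowers (b : A ⧸ (powMonoidHom p : A →* A).ker)) (c : A) :
    F c ∈ zpowers (F a) ⊔ zpowers (F b) ↔ c ∈ zpowers a ⊔ zpowers b := by
  set N := (powMonoidHom p : A →* A).ker
  have hmapA : (zpowers a ⊔ zpowers b).map (QuotientGroup.mk' N) =
      zpowers (a : A ⧸ N) ⊔ zpowers (b : A ⧸ N) := by
    rw [Subgroup.map_sup, MonoidHom.map_zpowers, MonoidHom.map_zpowers]; rfl
  have hmapG : (zpowers (F a) ⊔ zpowers (F b)).map (QuotientGroup.mk' W) =
      zpowers (F a : G ⧸ W) ⊔ zpowers (F b : G ⧸ W) := by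
    rw [Subgroup.map_sup, MonoidHom.map_zpowers, MonoidHom.map_zpowers]; rfl
  have himp (c : A) (hc : F c ∈ zpowers (F a) ⊔ zpowers (F b)) : c ∈ zpowers a ⊔ zpowers b := by
    have h1 := Subgroup.mem_map_of_mem (QuotientGroup.mk' W) hc
    rw [hmapG, QuotientGroup.mk'_apply, hmk, ← hmapA] at h1
    obtain ⟨h, hh, hhc⟩ := h1
    obtain ⟨u, v, ha, hb, hc'⟩ := hF.jointlyTwoGenerated a b c hc
    have hle : zpowers a ⊔ zpowers b ≤ zpowers u ⊔ zpowers v :=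
      sup_le (zpowers_le.mpr ha) (zpowers_le.mpr hb)
    have hw : h⁻¹ * c ∈ (zpowers u ⊔ zpowers v) ⊓ N :=
      mem_inf.mpr
      ⟨mul_mem (inv_mem (show h ∈ zpowers u ⊔ zpowers v from hle hh)) hc', QuotientGroup.eq.mp hhc⟩
    rw [← inf_ker_eq_of_mem hA hab hba ha hb] at hw
    have := mul_mem hh hw.1
    rwa [mul_inv_cancel_left] at this
  refine ⟨himp c, fun hc => ?_⟩
  have hab' := (hF.mem_zpowers_iff b a).not.mpr hab
  have hba' := (hF.mem_zpowers_iff a b).not.mpr hba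
  have hcard : Nat.card (zpowers a ⊔ zpowers b : Subgroup A) ≤
      Nat.card (zpowers (F a) ⊔ zpowers (F b) : Subgroup G) := by
    rw [← card_map_mul_card_inf_ker (QuotientGroup.mk' N),
      ← card_map_mul_card_inf_ker (QuotientGroup.mk' W), QuotientGroup.ker_mk',
      QuotientGroup.ker_mk', hmapA, hmapG]
    refine Nat.mul_le_mul (le_of_eq ?_) ((card_sup_zpowers_inf_ker_le a b).trans
      (sq_le_card_inf (hF.isPGroup hA) hW
        (fun _ _ h => hF.exists_eq_zpow_mul_of_pow_mem hA hW h) hab' hba'))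
    refine Nat.eq_of_mul_eq_mul_right (Nat.card_pos (α := W)) ?_
    rw [← card_comap_mk, ← hF.card_torsion_eq hW, ← card_comap_mk]
    exact Nat.card_congr (F.subtypeEquiv fun c => (hmk c).symm)
  have hsub : ((zpowers (F a) ⊔ zpowers (F b) : Subgroup G) : Set G) ⊆
      F '' (zpowers a ⊔ zpowers b : Subgroup A) := by
    intro z hz
    obtain ⟨y, rfl⟩ := F.surjective z
    exact ⟨y, himp y hz, rfl⟩
  have heq := Set.eq_of_subset_of_ncard_le hsub (by
    rw [Set.ncard_image_of_injective _ F.injective, ← Nat.card_coe_set_eq, ← Nat.card_coe_set_eq]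
    exact hcard) (Set.toFinite _)
  have : F c ∈ F '' (zpowers a ⊔ zpowers b : Subgroup A) := ⟨c, hc, rfl⟩
  rwa [← heq] at this

universe u v in
theorem mem_sup_iff_of_card_eq (p : ℕ) [Fact p.Prime] (n : ℕ) (A : Type u) (G : Type v)
    [CommGroup A] [Finite A] [Group G] [Finite G] (hn : Nat.card A = n) (e : A → G)
    (he : CyclicCorrespondence e) (hA : IsPGroup p A) (a b c : A) :
    e c ∈ zpowers (e a) ⊔ zpowers (e b) ↔ c ∈ zpowers a ⊔ zpowers b := by
  induction n using Nat.strong_induction_on generalizing A G with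
  | _ n ih =>
    obtain ⟨F, hFe⟩ := he.exists_equiv
    have hF := he.congr hFe
    rw [← zpowers_le, ← hFe, ← hFe, ← hFe, zpowers_le]
    by_cases hab : a ∈ zpowers b
    · rw [sup_eq_right.mpr (zpowers_le.mpr hab),
        sup_eq_right.mpr (zpowers_le.mpr ((hF.mem_zpowers_iff _ _).mpr hab)), hF.mem_zpowers_iff]
    by_cases hba : b ∈ zpowers a
    · rw [sup_eq_left.mpr (zpowers_le.mpr hba),
        sup_eq_left.mpr (zpowers_le.mpr ((hF.mem_zpowers_iff _ _).mpr hba)), hF.mem_zpowers_iff]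
    obtain ⟨W, hWn, hW⟩ := exists_torsion_subgroup (p := p) (G := G) fun _ _ =>
      commute_of_pow_eq_one (hF.isPGroup hA) (hF.ncard_pow_eq_one_le hA)
    refine hF.mem_sup_iff_of_mk hA hW hab hba (fun c => ?_) c
    have hlt : Nat.card (A ⧸ (powMonoidHom p : A →* A).ker) < n := by
      have hb1 : b ≠ 1 := by rintro rfl; exact hba (one_mem _)
      obtain ⟨z, -, hz⟩ := exists_pow_eq_one_mem_zpowers hA hb1
      have hker : 1 < Nat.card (powMonoidHom p : A →* A).ker := by
        rw [Subgroup.one_lt_card_iff_ne_bot]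
        intro hbot
        have : z ∈ (powMonoidHom p : A →* A).ker := by
          rw [MonoidHom.mem_ker, powMonoidHom_apply, ← hz, pow_orderOf_eq_one]
        rw [hbot, mem_bot] at this
        rw [this, orderOf_one] at hz
        exact (Fact.out : p.Prime).one_lt.ne hz
      rw [← hn, Subgroup.card_eq_card_quotient_mul_card_subgroup (powMonoidHom p : A →* A).ker]
      exact lt_mul_of_one_lt_right Nat.card_pos hker
    have := ih _ hlt _ (G ⧸ W) rfl _ (hF.quotient hA hW) (hA.to_quotient _) a b c
    rwa [← zpowers_le, hF.zpowers_mk_out_eq hA hW, hF.zpowers_mk_out_eq hA hW,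
      hF.zpowers_mk_out_eq hA hW, zpowers_le] at this

end PGroup

section Cocyclic

theorem Cocyclic.mem_or_mem {G : Type*} [Group G] [Finite G] {p i j : ℕ} (hp : p.Prime) {x y : G}
    (h : Cocyclic x y) (hx : x ^ p ^ i = 1) (hy : y ^ p ^ j = 1) :
    x ∈ zpowers y ∨ y ∈ zpowers x := by
  obtain ⟨z, hxz, hyz⟩ := h
  obtain ⟨k, -, hk⟩ := (Nat.dvd_prime_pow hp).mp (orderOf_dvd_of_pow_eq_one hx)
  obtain ⟨l, -, hl⟩ := (Nat.dvd_prime_pow hp).mp (orderOf_dvd_of_pow_eq_one hy)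
  rcases le_total k l with hkl | hkl
  · exact Or.inl (mem_zpowers_of_orderOf_dvd hyz hxz (hk ▸ hl ▸ pow_dvd_pow p hkl))
  · exact Or.inr (mem_zpowers_of_orderOf_dvd hxz hyz (hk ▸ hl ▸ pow_dvd_pow p hkl))

theorem exists_subset_zpowers_of_forall_primary {A : Type*} [CommGroup A] [Finite A] (S : Set A)
    (h : ∀ p, p.Prime → p ∣ Nat.card A → ∃ m : ℕ, ¬ p ∣ m ∧ ∃ t, ∀ s ∈ S, s ^ m ∈ zpowers t) :
    ∃ z : A, S ⊆ (zpowers z : Set A) := by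
  obtain ⟨z, hz⟩ := Monoid.exists_orderOf_eq_exponent
    (Monoid.ExponentExists.of_finite (G := closure S))
  refine ⟨z, fun s hs => mem_of_forall_primary_mem (N := Nat.card A) Nat.card_pos.ne'
    pow_card_eq_one' fun p hp hpA => ?_⟩
  obtain ⟨m, hpm, t, ht⟩ := h p hp hpA
  have hle : closure S ≤ (zpowers t).comap (powMonoidHom m) := (closure_le _).mpr ht
  refine ⟨m, hpm, zpowers_le.mpr (pow_mem (mem_zpowers z.1) m)
    (mem_zpowers_of_orderOf_dvd (hle z.2) (ht s hs) ?_)⟩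
  have hsz : orderOf s ∣ orderOf (z : A) := by
    rw [Subgroup.orderOf_coe, hz]
    have := Monoid.order_dvd_exponent (⟨s, subset_closure hs⟩ : closure S)
    rwa [← Subgroup.orderOf_coe] at this
  refine orderOf_dvd_of_pow_eq_one ?_
  rw [← pow_mul]
  refine orderOf_dvd_iff_pow_eq_one.mp (hsz.trans (orderOf_dvd_of_pow_eq_one ?_))
  rw [pow_mul]
  exact pow_orderOf_eq_one _

variable {G : Type*} [Group G] [Finite G]

open scoped IsMulCommutative in
theorem exists_subset_zpowers_of_pairwise_cocyclic (S : Set G)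
    (hS : ∀ x ∈ S, ∀ y ∈ S, Cocyclic x y) : ∃ z : G, S ⊆ (zpowers z : Set G) := by
  have := Subgroup.isMulCommutative_closure fun x hx y hy => (hS x hx y hy).commute.eq
  obtain rfl | ⟨s₁, hs₁⟩ := S.eq_empty_or_nonempty
  · exact ⟨1, Set.empty_subset _⟩
  obtain ⟨z, hz⟩ := exists_subset_zpowers_of_forall_primary
    (A := closure S) ((↑) ⁻¹' S) fun p hp hpS => by
      obtain ⟨m, hm1, hm, -⟩ := exists_primary_exponent p (Nat.card G) hp Nat.card_pos.ne'
      have hpow (s : G) : (s ^ m) ^ p ^ (Nat.card G).factorization p = 1 := by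
        rw [← pow_mul]
        exact orderOf_dvd_iff_pow_eq_one.mp ((orderOf_dvd_natCard s).trans hm)
      have hpG : p ∣ Nat.card G := hpS.trans (card_subgroup_dvd_card _)
      obtain ⟨s₀, hs₀, hmax⟩ := Set.exists_max_image S (fun s => orderOf (s ^ m)) S.toFinite
        ⟨s₁, hs₁⟩
      refine ⟨m, not_dvd_of_modEq_one hp (by simpa using hm1 1 (by rwa [pow_one])),
        ⟨s₀ ^ m, pow_mem (subset_closure hs₀) m⟩, fun s hs => ?_⟩
      have key : (s : G) ^ m ∈ zpowers (s₀ ^ m) := by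
        rcases ((hS s hs s₀ hs₀).mono (pow_mem (mem_zpowers _) m)
          (pow_mem (mem_zpowers _) m)).mem_or_mem hp (hpow s) (hpow s₀) with h | h
        · exact h
        · have h1 := orderOf_dvd_of_mem_zpowers h
          have h2 := Nat.dvd_antisymm h1 (dvd_of_eq
            (le_antisymm (hmax s hs) (Nat.le_of_dvd (orderOf_pos _) h1)))
          rw [zpowers_eq_of_mem_of_orderOf_eq h h2]
          exact mem_zpowers _
      obtain ⟨k, hk⟩ := mem_zpowers_iff.mp key
      exact mem_zpowers_iff.mpr ⟨k, Subtype.ext hk⟩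
  refine ⟨z, fun s hs => ?_⟩
  obtain ⟨k, hk⟩ := mem_zpowers_iff.mp (hz (show (⟨s, subset_closure hs⟩ : closure S) ∈ _ from hs))
  exact mem_zpowers_iff.mpr ⟨k, congrArg Subtype.val hk⟩

variable (G) in
/-- The subgroup of elements that are cocyclic with every element of the group. -/
def dominantSubgroup : Subgroup G where
  carrier := {x | ∀ y, Cocyclic x y}
  one_mem' y := ⟨y, one_mem _, mem_zpowers y⟩
  mul_mem' {a b} ha hb y := by
    obtain ⟨z, hz⟩ := exists_subset_zpowers_of_pairwise_cocyclic {a, b, y} <| by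
      rintro x (rfl | rfl | rfl) x' (rfl | rfl | rfl)
      exacts [.refl _, ha _, ha _, hb _, .refl _, hb _, (ha _).symm, (hb _).symm, .refl _]
    exact ⟨z, mul_mem (hz (by simp)) (hz (by simp)), hz (by simp)⟩
  inv_mem' {a} ha y := (ha y).mono (inv_mem (mem_zpowers a)) (mem_zpowers y)

theorem mem_dominantSubgroup {x : G} : x ∈ dominantSubgroup G ↔ ∀ y, Cocyclic x y := Iff.rfl

/-- The subgroup generated by an element and the dominant subgroup. -/
def dominantClosure (x : G) : Subgroup G := zpowers x ⊔ dominantSubgroup G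

theorem mem_dominantClosure_self (x : G) : x ∈ dominantClosure x :=
  le_sup_left (a := zpowers x) (mem_zpowers x)

theorem dominantClosure_le_iff {x y : G} :
    dominantClosure x ≤ dominantClosure y ↔ x ∈ dominantClosure y := by
  rw [dominantClosure, sup_le_iff, zpowers_le, and_iff_left]
  exact le_sup_right

theorem exists_subset_zpowers_of_dominant (S : Set G) (hS : ∀ x ∈ S, ∀ y ∈ S, Cocyclic x y) :
    ∃ z : G, S ⊆ (zpowers z : Set G) ∧ dominantSubgroup G ≤ zpowers z := by
  obtain ⟨z, hz⟩ := exists_subset_zpowers_of_pairwise_cocyclic (S ∪ dominantSubgroup G) <| by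
    rintro x (hx | hx) y (hy | hy)
    exacts [hS x hx y hy, (hy x).symm, hx y, hx y]
  exact ⟨z, Set.subset_union_left.trans hz, Set.subset_union_right.trans hz⟩

theorem exists_dominantClosure_eq_zpowers (x : G) : ∃ z, dominantClosure x = zpowers z := by
  obtain ⟨z, hz, hd⟩ := exists_subset_zpowers_of_dominant {x} <| by
    rintro _ rfl _ rfl
    exact .refl _
  exact exists_zpowers_eq_of_le (sup_le (zpowers_le.mpr (hz rfl)) hd)

theorem exists_orderOf_eq_of_dvd {z : G} {n : ℕ} (h : n ∣ orderOf z) :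
    ∃ t ∈ zpowers z, orderOf t = n :=
  ⟨_, pow_mem (mem_zpowers z) _, orderOf_pow_orderOf_div (orderOf_pos z).ne' h⟩

theorem card_dominantClosure (x : G) : Nat.card (dominantClosure x) =
    (orderOf x).lcm (Nat.card (dominantSubgroup G)) := by
  obtain ⟨z, hz⟩ := exists_dominantClosure_eq_zpowers x
  obtain ⟨d, hd⟩ := exists_zpowers_eq_of_le
    (show dominantSubgroup G ≤ zpowers z from hz ▸ le_sup_right)
  have hx : x ∈ zpowers z := hz ▸ mem_dominantClosure_self x
  have hdz : d ∈ zpowers z := by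
    rw [← zpowers_le, ← hd, ← hz]
    exact le_sup_right
  refine Nat.dvd_antisymm ?_ (Nat.lcm_dvd ?_ (card_dvd_of_le le_sup_right))
  · obtain ⟨t, htz, ht⟩ := exists_orderOf_eq_of_dvd (Nat.lcm_dvd
      (orderOf_dvd_of_mem_zpowers hx) (orderOf_dvd_of_mem_zpowers hdz))
    rw [hd, Nat.card_zpowers, ← ht, ← Nat.card_zpowers t]
    refine card_dvd_of_le (sup_le (zpowers_le.mpr ?_) ?_)
    · exact mem_zpowers_of_orderOf_dvd htz hx (ht ▸ Nat.dvd_lcm_left _ _)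
    · rw [hd, zpowers_le]
      exact mem_zpowers_of_orderOf_dvd htz hdz (ht ▸ Nat.dvd_lcm_right _ _)
  · rw [← Nat.card_zpowers]
    exact card_dvd_of_le le_sup_left

end Cocyclic

section CommGroup

variable {A : Type*} [CommGroup A] [Finite A]

theorem cocyclic_of_pow_eq_one {p k m : ℕ} (hp : p.Prime) {x y t : A} (hy : y ^ p ^ k = 1)
    (hpm : ¬ p ∣ m) (hyt : y ∈ zpowers t) (hxt : x ^ m ∈ zpowers t) : Cocyclic y x := by
  obtain ⟨z, hz⟩ := exists_subset_zpowers_of_forall_primary {y, x} fun q hq _ => by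
    by_cases hqp : q = p
    · subst hqp
      refine ⟨m, hpm, t, ?_⟩
      rintro s (rfl | rfl)
      exacts [pow_mem hyt m, hxt]
    · refine ⟨p ^ k, fun h => hqp ((Nat.prime_dvd_prime_iff_eq hq hp).mp (hq.dvd_of_dvd_pow h)),
        x ^ p ^ k, ?_⟩
      rintro s (rfl | rfl)
      exacts [hy ▸ one_mem _, mem_zpowers _]
  exact ⟨z, hz (by simp), hz (by simp)⟩

theorem exists_pow_eq_one_notMem_zpowers {p k : ℕ} [Fact p.Prime] {y : A} (hy : y ^ p ^ k = 1)
    (h : y ∉ dominantSubgroup A) : ∃ b, b ^ p = 1 ∧ b ∉ zpowers y := by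
  have hp : p.Prime := Fact.out
  by_contra! hb
  refine h fun t => ?_
  obtain ⟨m, hm1, hm, -⟩ := exists_primary_exponent p (Nat.card A) hp Nat.card_pos.ne'
  by_cases hpA : p ∣ Nat.card A
  · have hpm : ¬ p ∣ m := not_dvd_of_modEq_one hp (by simpa using hm1 1 (by rwa [pow_one]))
    have ht : (t ^ m) ^ p ^ (Nat.card A).factorization p = 1 := by
      rw [← pow_mul]
      exact orderOf_dvd_iff_pow_eq_one.mp ((orderOf_dvd_natCard t).trans hm)
    by_cases h1 : t ^ m ∈ zpowers y
    · exact cocyclic_of_pow_eq_one hp hy hpm (mem_zpowers y) h1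
    by_cases h2 : y ∈ zpowers (t ^ m)
    · exact cocyclic_of_pow_eq_one hp hy hpm h2 (mem_zpowers _)
    obtain ⟨w, -, hw, hwy⟩ := exists_mem_sup_notMem_zpowers (W := (powMonoidHom p).ker) ht hy
      (fun _ => exists_eq_zpow_mul_of_pow_mem) h1 h2
    exact absurd (hb w hw) hwy
  · have hy1 : y = 1 := orderOf_eq_one_iff.mp <| Nat.Coprime.eq_one_of_dvd
      (Nat.Coprime.coprime_dvd_left (orderOf_dvd_of_pow_eq_one hy)
        (((Nat.Prime.coprime_iff_not_dvd hp).mpr hpA).pow_left k)) (orderOf_dvd_natCard y)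
    exact ⟨t, hy1 ▸ one_mem _, mem_zpowers t⟩

theorem mem_dominantClosure_of_forall_cocyclic {x y : A}
    (h : ∀ z, Cocyclic z x → Cocyclic z y) : y ∈ dominantClosure x := by
  refine mem_of_forall_primary_mem Nat.card_pos.ne' (pow_card_eq_one' (x := y)) fun p hp hpA => ?_
  have : Fact p.Prime := ⟨hp⟩
  obtain ⟨m, hm1, hm, -⟩ := exists_primary_exponent p (Nat.card A) hp Nat.card_pos.ne'
  have hpm : ¬ p ∣ m := not_dvd_of_modEq_one hp (by simpa using hm1 1 (by rwa [pow_one]))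
  refine ⟨m, hpm, ?_⟩
  have hpow (t : A) : (t ^ m) ^ p ^ (Nat.card A).factorization p = 1 := by
    rw [← pow_mul]
    exact orderOf_dvd_iff_pow_eq_one.mp ((orderOf_dvd_natCard t).trans hm)
  replace h (z : A) (hz : Cocyclic z x) : Cocyclic z (y ^ m) :=
    (h z hz).mono (mem_zpowers z) (pow_mem (mem_zpowers y) m)
  have hy := hpow y
  generalize y ^ m = y at h hy
  by_contra hyx
  have hyx' : y ∉ zpowers (x ^ m) := fun h1 =>
    hyx (zpowers_le.mpr (pow_mem (mem_dominantClosure_self x) m) h1)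
  obtain ⟨b, hb, hby⟩ := exists_pow_eq_one_notMem_zpowers hy fun h1 =>
    hyx (le_sup_right (a := zpowers x) h1)
  have hxy : x ^ m ∈ zpowers y := ((h x (.refl x)).mono (pow_mem (mem_zpowers x) m)
    (mem_zpowers y)).mem_or_mem hp (hpow x) hy |>.resolve_right hyx'
  obtain ⟨i, hi⟩ := mem_zpowers_iff.mp hxy
  have hpi : (p : ℤ) ∣ i := by
    by_contra hpi
    exact hyx' (mem_zpowers_of_pow_eq_of_not_dvd hy ((pow_one _).trans hi.symm) hpi)
  obtain ⟨j, rfl⟩ := hpi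
  have hyb : (y * b) ^ p = y ^ p := by rw [mul_pow, hb, mul_one]
  have hxyb : x ^ m ∈ zpowers (y * b) := by
    rw [← hi, zpow_mul, zpow_natCast, ← hyb]
    exact zpow_mem (pow_mem (mem_zpowers _) _) _
  have hyb1 : (y * b) ^ p ^ ((Nat.card A).factorization p + 1) = 1 := by
    rw [pow_succ', pow_mul, hyb, ← pow_mul, mul_comm, pow_mul, hy, one_pow]
  obtain ⟨w, h1, h2⟩ := h _ (cocyclic_of_pow_eq_one hp hyb1 hpm (mem_zpowers _) hxyb)
  have hbw : b ∈ zpowers w := by simpa using mul_mem (inv_mem h2) h1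
  refine hby (mem_zpowers_of_orderOf_dvd h2 hbw ((orderOf_dvd_of_pow_eq_one hb).trans ?_))
  obtain ⟨k, -, hk⟩ := (Nat.dvd_prime_pow hp).mp (orderOf_dvd_of_pow_eq_one hy)
  rcases k with _ | k
  · rw [pow_zero, orderOf_eq_one_iff] at hk
    exact absurd (hk ▸ one_mem _) hyx
  · exact hk ▸ dvd_pow_self p k.succ_ne_zero

end CommGroup

section CocyclicEquiv

variable {A G : Type*} [CommGroup A] [Finite A] [Group G] [Finite G] {φ : A ≃ G}
  (hφ : ∀ x y, Cocyclic (φ x) (φ y) ↔ Cocyclic x y)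
include hφ

theorem mem_dominantClosure_of_map {x y : A} (h : φ y ∈ dominantClosure (φ x)) :
    y ∈ dominantClosure x := by
  refine mem_dominantClosure_of_forall_cocyclic fun z hz => (hφ z y).mp ?_
  obtain ⟨w, hw, hd⟩ := exists_subset_zpowers_of_dominant {φ z, φ x} <| by
    rintro s (rfl | rfl) t (rfl | rfl)
    exacts [.refl _, (hφ z x).mpr hz, ((hφ z x).mpr hz).symm, .refl _]
  exact ⟨w, hw (by simp), sup_le (zpowers_le.mpr (hw (by simp))) hd h⟩

theorem card_dominantSubgroup_eq :
    Nat.card (dominantSubgroup G) = Nat.card (dominantSubgroup A) := by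
  refine Nat.card_congr (φ.subtypeEquiv fun x => ?_).symm
  simp only [mem_dominantSubgroup, φ.surjective.forall, hφ]

theorem card_dominantClosure_map (x : A) :
    Nat.card (dominantClosure (φ x)) = Nat.card (dominantClosure x) := by
  obtain ⟨w, hxw, hmax⟩ := Set.exists_max_image {w : A | x ∈ zpowers w} orderOf (Set.toFinite _)
    ⟨x, mem_zpowers x⟩
  obtain ⟨y, hy⟩ := exists_subset_zpowers_of_pairwise_cocyclic (φ '' zpowers w) <| by
    rintro _ ⟨s, hs, rfl⟩ _ ⟨t, ht, rfl⟩
    exact (hφ s t).mpr ⟨w, hs, ht⟩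
  obtain ⟨v, hv⟩ := exists_subset_zpowers_of_pairwise_cocyclic (φ ⁻¹' zpowers y)
    fun s hs t ht => (hφ s t).mp ⟨y, hs, ht⟩
  have hwv : w ∈ zpowers v := hv (hy ⟨w, mem_zpowers w, rfl⟩)
  have hvw : zpowers w = zpowers v := zpowers_eq_of_mem_of_orderOf_eq hwv <|
    le_antisymm (Nat.le_of_dvd (orderOf_pos v) (orderOf_dvd_of_mem_zpowers hwv))
      (hmax v (zpowers_le.mpr hwv hxw))
  let σ : zpowers w ≃ zpowers y := φ.subtypeEquiv fun a =>
    ⟨fun ha => hy ⟨a, ha, rfl⟩, fun ha => hvw ▸ hv ha⟩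
  obtain ⟨τ⟩ := exists_mulEquiv_zpowers (x := w) (y := y) <| by
    rw [← Nat.card_zpowers, ← Nat.card_zpowers]
    exact Nat.card_congr σ
  have := Fintype.ofFinite (zpowers w)
  have := Fintype.ofFinite (zpowers y)
  have hle (a : A) : Nat.card (dominantClosure (φ a)) ≤ Nat.card (dominantClosure a) :=
    Nat.card_le_card_of_injective
      (fun b : dominantClosure (φ a) => (⟨φ.symm b, mem_dominantClosure_of_map hφ (by
        rw [φ.apply_symm_apply]; exact b.2)⟩ : dominantClosure a))
      fun b c h => Subtype.ext (φ.symm.injective (congrArg Subtype.val h))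
  have hsum : ∑ a : zpowers w, Nat.card (dominantClosure (φ a)) =
      ∑ a : zpowers w, Nat.card (dominantClosure (a : A)) := by
    calc _ = ∑ b : zpowers y, Nat.card (dominantClosure (b : G)) :=
          Equiv.sum_comp σ fun b => Nat.card (dominantClosure (b : G))
      _ = _ := by
        rw [← Equiv.sum_comp τ.toEquiv]
        refine Finset.sum_congr rfl fun a _ => ?_
        rw [card_dominantClosure, card_dominantClosure, card_dominantSubgroup_eq hφ,
          Subgroup.orderOf_coe, MulEquiv.toEquiv_eq_coe, EquivLike.coe_coe, τ.orderOf_eq,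
          Subgroup.orderOf_coe]
  exact (Finset.sum_eq_sum_iff_of_le fun (a : zpowers w) _ => hle a).mp hsum ⟨x, hxw⟩
    (Finset.mem_univ _)

theorem mem_dominantClosure_map_iff {x y : A} :
    φ y ∈ dominantClosure (φ x) ↔ y ∈ dominantClosure x := by
  refine ⟨mem_dominantClosure_of_map hφ, fun h => ?_⟩
  have heq : φ ⁻¹' dominantClosure (φ x) = (dominantClosure x : Set A) :=
    Set.eq_of_subset_of_ncard_le (fun _ => mem_dominantClosure_of_map hφ) <| by
      rw [← Set.ncard_image_of_injective (φ ⁻¹' _) φ.injective, φ.image_preimage]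
      exact (card_dominantClosure_map hφ x).ge
  exact heq.ge h

theorem exists_cyclicCorrespondence (hJ : ∀ a b c, JointlyTwoGenerated (φ a) (φ b) (φ c) →
    JointlyTwoGenerated a b c) : ∃ e : A → G, CyclicCorrespondence e := by
  have hex (x : A) : ∃ t ∈ dominantClosure (φ x), orderOf t = orderOf x := by
    obtain ⟨z, hz⟩ := exists_dominantClosure_eq_zpowers (φ x)
    rw [hz]
    refine exists_orderOf_eq_of_dvd ?_
    rw [← Nat.card_zpowers z, ← hz, card_dominantClosure_map hφ, card_dominantClosure]
    exact Nat.dvd_lcm_left _ _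
  choose e he ho using hex
  have hcl (x : A) : dominantClosure (e x) = dominantClosure (φ x) := by
    refine eq_of_le_of_card_ge (dominantClosure_le_iff.mpr (he x)) ?_
    rw [card_dominantClosure_map hφ, card_dominantClosure, card_dominantClosure, ho,
      card_dominantSubgroup_eq hφ]
  have hmap (x y : A) : dominantClosure (φ y) ≤ dominantClosure (φ x) ↔ y ∈ dominantClosure x := by
    rw [dominantClosure_le_iff, mem_dominantClosure_map_iff hφ]
  refine ⟨e, ho, fun x y => ⟨fun h => ?_, fun h => ?_⟩, fun b => ?_, fun a b c h => hJ a b c ?_⟩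
  · have hy : y ∈ dominantClosure x := by
      rw [← hmap, ← hcl, ← hcl, dominantClosure_le_iff]
      exact le_sup_left (a := zpowers (e x)) h
    obtain ⟨t, ht⟩ := exists_dominantClosure_eq_zpowers x
    exact mem_zpowers_of_orderOf_dvd (ht ▸ mem_dominantClosure_self x) (ht ▸ hy)
      (ho x ▸ ho y ▸ orderOf_dvd_of_mem_zpowers h)
  · have hy := (hmap x y).mpr (le_sup_left (a := zpowers x) h)
    obtain ⟨t, ht⟩ := exists_dominantClosure_eq_zpowers (φ x)
    refine mem_zpowers_of_orderOf_dvd (ht ▸ he x) (ht ▸ hy (he y)) ?_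
    rw [ho, ho]
    exact orderOf_dvd_of_mem_zpowers h
  · obtain ⟨x, rfl⟩ := φ.surjective b
    obtain ⟨t, ht⟩ := exists_dominantClosure_eq_zpowers x
    obtain ⟨a, hat, ha⟩ := exists_orderOf_eq_of_dvd (z := t) (n := orderOf (φ x)) <| by
      rw [← Nat.card_zpowers t, ← ht, ← card_dominantClosure_map hφ, card_dominantClosure]
      exact Nat.dvd_lcm_left _ _
    obtain ⟨z, hz⟩ := exists_dominantClosure_eq_zpowers (φ x)
    have haz := (hmap x a).mpr (ht ▸ hat) (he a)
    have hoa : orderOf (e a) = orderOf (φ x) := (ho a).trans ha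
    exact ⟨a, zpowers_eq_of_mem_of_orderOf_eq (mem_zpowers_of_orderOf_dvd
      (hz ▸ mem_dominantClosure_self (φ x)) (hz ▸ haz) (dvd_of_eq hoa)) hoa⟩
  · obtain ⟨u, hu⟩ := exists_dominantClosure_eq_zpowers (e a)
    obtain ⟨v, hv⟩ := exists_dominantClosure_eq_zpowers (e b)
    have hself (x : A) : φ x ∈ dominantClosure (e x) := hcl x ▸ mem_dominantClosure_self _
    refine ⟨u, v, ?_, ?_, ?_⟩ <;> rw [← hu, ← hv]
    · exact le_sup_left (a := dominantClosure (e a)) (hself a)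
    · exact le_sup_right (a := dominantClosure (e a)) (hself b)
    · refine sup_le (zpowers_le.mpr ?_) ?_ (hself c)
      · have hle : zpowers (e a) ⊔ zpowers (e b) ≤ dominantClosure (e a) ⊔ dominantClosure (e b) :=
          sup_le_sup le_sup_left le_sup_left
        exact hle h
      · exact le_sup_right.trans (le_sup_left (a := dominantClosure (e a)))

end CocyclicEquiv

section PrimaryDecomposition

theorem mem_sup_zpowers_coe_iff {G : Type*} [Group G] {H : Subgroup G} {x u v : H} :
    (x : G) ∈ zpowers (u : G) ⊔ zpowers (v : G) ↔ x ∈ zpowers u ⊔ zpowers v := by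
  rw [← mem_map_iff_mem H.subtype_injective, Subgroup.map_sup, MonoidHom.map_zpowers,
    MonoidHom.map_zpowers]
  rfl

theorem mem_zpowers_coe_iff {G : Type*} [Group G] {H : Subgroup G} {x u : H} :
    (x : G) ∈ zpowers (u : G) ↔ x ∈ zpowers u := by
  simpa using mem_sup_zpowers_coe_iff (x := x) (u := u) (v := u)

theorem pow_mem_sup_zpowers_pow {G : Type*} [Group G] {m : ℕ}
    (hmul : ∀ x y : G, (x * y) ^ m = x ^ m * y ^ m) {a b c : G} (h : c ∈ zpowers a ⊔ zpowers b) :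
    c ^ m ∈ zpowers (a ^ m) ⊔ zpowers (b ^ m) := by
  let π : G →* G := MonoidHom.mk' (· ^ m) hmul
  have := mem_map_of_mem π h
  rwa [Subgroup.map_sup, MonoidHom.map_zpowers, MonoidHom.map_zpowers] at this

/-- In a finite group whose Sylow subgroups are normal, projecting onto the `p`-elements is
multiplicative. -/
theorem mul_pow_of_sylow_normal {G : Type*} [Group G] [Finite G]
    (hn : ∀ {p : ℕ} [Fact p.Prime] (P : Sylow p G), (P : Subgroup G).Normal) {p m : ℕ}
    (hm1 : ∀ k, p ^ k ∣ Nat.card G → m ≡ 1 [MOD p ^ k])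
    (hm0 : ∀ q, q.Prime → q ≠ p → ∀ k, q ^ k ∣ Nat.card G → q ^ k ∣ m) (x y : G) :
    (x * y) ^ m = x ^ m * y ^ m := by
  obtain ⟨x, rfl⟩ := (Sylow.directProductOfNormal hn).surjective x
  obtain ⟨y, rfl⟩ := (Sylow.directProductOfNormal hn).surjective y
  simp only [← map_mul, ← map_pow]
  congr 1
  ext ⟨q, hq⟩ Q
  congr 1
  have := Fact.mk (Nat.prime_of_mem_primeFactors hq)
  have hQ : Nat.card Q = q ^ (Nat.card G).factorization q := Q.card_eq_multiplicity
  simp only [Pi.pow_apply, Pi.mul_apply]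
  have hdvd : q ^ (Nat.card G).factorization q ∣ Nat.card G := Nat.ordProj_dvd _ _
  by_cases hqp : q = p
  · subst hqp
    have hpow (z : Q) : z ^ m = z := by
      conv_rhs => rw [← pow_one z]
      rw [pow_eq_pow_iff_modEq]
      exact (hm1 _ hdvd).of_dvd (hQ ▸ orderOf_dvd_natCard z)
    simp only [hpow]
  · have hpow (z : Q) : z ^ m = 1 := orderOf_dvd_iff_pow_eq_one.mp <|
      (orderOf_dvd_natCard z).trans (hQ ▸ hm0 q Fact.out hqp _ hdvd)
    simp only [hpow, mul_one]

namespace CyclicCorrespondence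

variable {A G : Type*} [CommGroup A] [Finite A] [Group G] [Finite G] {F : A ≃ G}
  (hF : CyclicCorrespondence F)
include hF

theorem sylow_normal {p : ℕ} [Fact p.Prime] (P : Sylow p G) : (P : Subgroup G).Normal := by
  have hP : Nat.card P = p ^ (Nat.card G).factorization p := P.card_eq_multiplicity
  set q := p ^ (Nat.card G).factorization p with hq
  have hker : Nat.card (powMonoidHom q : A →* A).ker ≤ q := by
    obtain ⟨n, hn⟩ := IsPGroup.iff_card.mp <| show IsPGroup p (powMonoidHom q : A →* A).ker from
      fun a => ⟨_, Subtype.ext a.2⟩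
    rw [hn, hq]
    refine Nat.pow_le_pow_right (Nat.Prime.pos Fact.out) ?_
    rw [← Nat.Prime.pow_dvd_iff_le_factorization Fact.out Nat.card_pos.ne', ← hn,
      ← Nat.card_congr F]
    exact card_subgroup_dvd_card _
  have heq : (P : Set G) = F '' (powMonoidHom q : A →* A).ker := by
    refine Set.eq_of_subset_of_ncard_le (fun g hg => ⟨F.symm g, ?_, F.apply_symm_apply g⟩) ?_
    · rw [SetLike.mem_coe, MonoidHom.mem_ker, powMonoidHom_apply, ← hF.pow_eq_one_iff,
        F.apply_symm_apply, ← hP]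
      exact congrArg Subtype.val (pow_card_eq_one' (x := (⟨g, hg⟩ : P)))
    · rw [Set.ncard_image_of_injective _ F.injective]
      exact hker.trans hP.ge
  have hmem (g : G) : g ∈ (P : Subgroup G) ↔ g ^ q = 1 := by
    rw [← SetLike.mem_coe, Sylow.coe_coe, heq, Set.mem_image_equiv, SetLike.mem_coe,
      MonoidHom.mem_ker, powMonoidHom_apply, ← hF.pow_eq_one_iff, F.apply_symm_apply]
  exact ⟨fun n hn g => by rw [hmem] at hn ⊢; rw [conj_pow, hn, mul_one, mul_inv_cancel]⟩

theorem pow_mem_sup_iff {p k m : ℕ} [Fact p.Prime] (hidem : ∀ x : A, (x ^ m) ^ m = x ^ m)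
    (hpow : ∀ x : A, (x ^ m) ^ p ^ k = 1) (hmul : ∀ x y : G, (x * y) ^ m = x ^ m * y ^ m)
    (a b c : A) : F c ^ m ∈ zpowers (F a ^ m) ⊔ zpowers (F b ^ m) ↔
      c ^ m ∈ zpowers (a ^ m) ⊔ zpowers (b ^ m) := by
  let A' := (powMonoidHom m : A →* A).range
  let G' := (MonoidHom.mk' (fun x : G => x ^ m) hmul).range
  have hmem (x : A') : F x ∈ G' := by
    obtain ⟨_, y, rfl⟩ := x
    exact zpowers_le.mp ((hF.zpowers_map_pow y m).trans_le (zpowers_le.mpr ⟨F y, rfl⟩))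
  let e (x : A') : G' := ⟨F x, hmem x⟩
  have he : CyclicCorrespondence e := by
    refine ⟨fun x => ?_, fun x y => ?_, ?_, fun x y z h => ?_⟩
    · rw [Subgroup.orderOf_mk, hF.orderOf_eq, Subgroup.orderOf_coe]
    · rw [← mem_zpowers_coe_iff, ← mem_zpowers_coe_iff]
      exact hF.mem_zpowers_iff _ _
    · rintro ⟨_, g, rfl⟩
      refine ⟨⟨F.symm g ^ m, F.symm g, rfl⟩, ?_⟩
      have := hF.zpowers_map_pow (F.symm g) m
      rw [F.apply_symm_apply] at this
      refine le_antisymm ?_ ?_ <;> rw [zpowers_le, ← mem_zpowers_coe_iff, ← zpowers_le]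
      exacts [this.le, this.ge]
    · obtain ⟨u, v, hx, hy, hz⟩ := hF.jointlyTwoGenerated x y z
        ((mem_sup_zpowers_coe_iff (x := e z) (u := e x) (v := e y)).mpr h)
      have hproj (w : A') (hw : (w : A) ∈ zpowers u ⊔ zpowers v) :
          w ∈ zpowers (⟨u ^ m, u, rfl⟩ : A') ⊔ zpowers ⟨v ^ m, v, rfl⟩ := by
        rw [← mem_sup_zpowers_coe_iff]
        have hwm : (w : A) ^ m = w := by
          obtain ⟨t, ht⟩ := w.2
          rw [← ht]
          exact hidem t
        exact hwm ▸ pow_mem_sup_zpowers_pow (fun s t => mul_pow s t m) hw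
      exact ⟨_, _, hproj x hx, hproj y hy, hproj z hz⟩
  have hA' : IsPGroup p A' := by
    rintro ⟨_, t, rfl⟩
    exact ⟨k, Subtype.ext (hpow t)⟩
  have key := mem_sup_iff_of_card_eq p _ A' G' rfl e he hA' ⟨a ^ m, a, rfl⟩ ⟨b ^ m, b, rfl⟩
    ⟨c ^ m, c, rfl⟩
  rw [← mem_sup_zpowers_coe_iff, ← mem_sup_zpowers_coe_iff] at key
  rw [← key, ← zpowers_le, ← hF.zpowers_map_pow, ← hF.zpowers_map_pow, ← hF.zpowers_map_pow,
    zpowers_le]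

theorem mem_sup_iff (a b c : A) :
    F c ∈ zpowers (F a) ⊔ zpowers (F b) ↔ c ∈ zpowers a ⊔ zpowers b := by
  have key (p : ℕ) (hp : p.Prime) (hpA : p ∣ Nat.card A) : ∃ m : ℕ, ¬ p ∣ m ∧
      (∀ x y : G, (x * y) ^ m = x ^ m * y ^ m) ∧
      (F c ^ m ∈ zpowers (F a ^ m) ⊔ zpowers (F b ^ m) ↔
        c ^ m ∈ zpowers (a ^ m) ⊔ zpowers (b ^ m)) := by
    have : Fact p.Prime := ⟨hp⟩
    obtain ⟨m, hm1, hm, hm0⟩ := exists_primary_exponent p (Nat.card A) hp Nat.card_pos.ne'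
    have hpow (x : A) : (x ^ m) ^ p ^ (Nat.card A).factorization p = 1 := by
      rw [← pow_mul]
      exact orderOf_dvd_iff_pow_eq_one.mp ((orderOf_dvd_natCard x).trans hm)
    have hmul : ∀ x y : G, (x * y) ^ m = x ^ m * y ^ m := by
      rw [Nat.card_congr F] at hm1 hm0
      exact mul_pow_of_sylow_normal hF.sylow_normal hm1 hm0
    refine ⟨m, not_dvd_of_modEq_one hp (by simpa using hm1 1 (by rwa [pow_one])), hmul,
      hF.pow_mem_sup_iff (fun x => ?_) hpow hmul a b c⟩
    conv_rhs => rw [← pow_one (x ^ m)]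
    exact pow_eq_pow_iff_modEq.mpr
      ((hm1 _ (Nat.ordProj_dvd _ _)).of_dvd (orderOf_dvd_of_pow_eq_one (hpow x)))
  constructor <;> intro h
  · refine mem_of_forall_primary_mem Nat.card_pos.ne' (pow_card_eq_one' (x := c)) fun p hp hpA => ?_
    obtain ⟨m, hpm, hmul, hiff⟩ := key p hp hpA
    exact ⟨m, hpm, sup_le_sup (zpowers_le.mpr (pow_mem (mem_zpowers a) m))
      (zpowers_le.mpr (pow_mem (mem_zpowers b) m)) (hiff.mp (pow_mem_sup_zpowers_pow hmul h))⟩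
  · refine mem_of_forall_primary_mem Nat.card_pos.ne' (pow_card_eq_one' (x := F c))
      fun p hp hpG => ?_
    obtain ⟨m, hpm, -, hiff⟩ := key p hp (Nat.card_congr F ▸ hpG)
    exact ⟨m, hpm, sup_le_sup (zpowers_le.mpr (pow_mem (mem_zpowers (F a)) m))
      (zpowers_le.mpr (pow_mem (mem_zpowers (F b)) m))
      (hiff.mpr (pow_mem_sup_zpowers_pow (fun s t => mul_pow s t m) h))⟩

end CyclicCorrespondence

end PrimaryDecomposition

section SubgroupLattice

variable {A B : Type*} [Group A] [Group B]

/-- The image of a subgroup under a bijection whose inverse preserves membership in two-generated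
subgroups. -/
def subgroupImage (F : A ≃ B)
    (hF : ∀ a b c, F c ∈ zpowers (F a) ⊔ zpowers (F b) → c ∈ zpowers a ⊔ zpowers b)
    (H : Subgroup A) : Subgroup B :=
  have key {x y z : B} (hx : F.symm x ∈ H) (hy : F.symm y ∈ H)
      (hz : z ∈ zpowers x ⊔ zpowers y) : F.symm z ∈ H :=
    sup_le (zpowers_le.mpr hx) (zpowers_le.mpr hy) (hF _ _ _ (by simpa using hz))
  { carrier := F.symm ⁻¹' H
    mul_mem' := fun {x y} hx hy =>
      key hx hy (mul_mem (mem_sup_zpowers_left x y) (mem_sup_zpowers_right x y))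
    one_mem' := key (x := F 1) (y := F 1) (by simp) (by simp) (one_mem _)
    inv_mem' := fun {x} hx => key hx hx (inv_mem (mem_sup_zpowers_left x x)) }

theorem mem_subgroupImage {F : A ≃ B} {hF} {H : Subgroup A} {x : B} :
    x ∈ subgroupImage F hF H ↔ F.symm x ∈ H := Iff.rfl

/-- A bijection preserving membership in two-generated subgroups induces an isomorphism of
subgroup lattices. -/
def subgroupOrderIso (F : A ≃ B)
    (hF : ∀ a b c, F c ∈ zpowers (F a) ⊔ zpowers (F b) ↔ c ∈ zpowers a ⊔ zpowers b) :
    Subgroup A ≃o Subgroup B where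
  toFun := subgroupImage F fun a b c => (hF a b c).mp
  invFun := subgroupImage F.symm fun a b c h => by simpa using (hF _ _ _).mpr h
  left_inv H := by ext x; simp [mem_subgroupImage]
  right_inv H := by ext x; simp [mem_subgroupImage]
  map_rel_iff' {H K} := (F.symm.surjective.forall (p := fun x => x ∈ H → x ∈ K)).symm

end SubgroupLattice

theorem strong_independence_iso_abelian_implies_lattice_iso
    (G₁ G₂ : Type) [CommGroup G₁] [Finite G₁] [Group G₂] [Finite G₂]
    (h : ∃ φ : G₁ ≃ G₂, ∀ X : Set G₁,
          StronglyIndependent X ↔ StronglyIndependent (φ '' X)) :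
    Nonempty (Subgroup G₁ ≃o Subgroup G₂) := by
  obtain ⟨φ, hφ⟩ := h
  obtain ⟨e, he⟩ := exists_cyclicCorrespondence (cocyclic_iff_of_iso φ hφ)
    fun _ _ _ => jointlyTwoGenerated_of_iso φ hφ
  obtain ⟨F, hF⟩ := he.exists_equiv
  exact ⟨subgroupOrderIso F (he.congr hF).mem_sup_iff⟩
end

section
/- Let p be a prime and let G1 and G2 be finite p-groups with G1 abelian. The following are equivalent: (1) the independence complexes Σ(G1) and Σ(G2) are isomorphic; (2) the strong independence complexes Σ̃(G1) and Σ̃(G2) are isomorphic; (3) the subgroup lattices of G1 and G2 are isomorphic as lattices. -/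
namespace PGroupPower

open Subgroup

section General

variable {p : ℕ} [Fact p.Prime] {G : Type*} [Group G]

theorem mem_zpowers_zpow_of_not_dvd (hG : IsPGroup p G) (x : G) {i : ℤ} (hi : ¬ (p : ℤ) ∣ i) :
    x ∈ zpowers (x ^ i) := by
  obtain ⟨k, hk⟩ := IsPGroup.iff_orderOf.1 hG x
  rw [mem_zpowers_zpow_iff, hk]
  have h1 : Nat.Coprime p i.natAbs := by
    rw [Nat.Prime.coprime_iff_not_dvd Fact.out]
    rwa [← Int.natCast_dvd]
  have := (Nat.Coprime.pow_left k h1).symm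
  simpa [Int.gcd, Nat.Coprime] using this

theorem eq_one_of_mem_zpowers_pow (hG : IsPGroup p G) {x : G} (h : x ∈ zpowers (x ^ p)) :
    x = 1 := by
  by_contra hx
  have h1 := hG.dvd_orderOf hx
  rw [mem_zpowers_pow_iff, Nat.gcd_eq_left h1] at h
  exact (Fact.out : p.Prime).ne_one h

theorem mem_zpowers_pow_of_mem (hG : IsPGroup p G) {u x : G} (hu : u ∈ zpowers x)
    (hx : x ∉ zpowers u) : u ∈ zpowers (x ^ p) := by
  obtain ⟨i, rfl⟩ := mem_zpowers_iff.1 hu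
  by_cases hi : (p : ℤ) ∣ i
  · obtain ⟨j, rfl⟩ := hi
    exact mem_zpowers_iff.2 ⟨j, by rw [zpow_mul, zpow_natCast]⟩
  · exact absurd (mem_zpowers_zpow_of_not_dvd hG x hi) hx

theorem mem_of_zpow_mem (hG : IsPGroup p G) {H : Subgroup G} {x : G} {i : ℤ}
    (hi : ¬ (p : ℤ) ∣ i) (h : x ^ i ∈ H) : x ∈ H :=
  (zpowers_le.2 h) (mem_zpowers_zpow_of_not_dvd hG x hi)

theorem card_zpowers_eq_mul [Finite G] (hG : IsPGroup p G) {x : G} (hx : x ≠ 1) :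
    Nat.card (zpowers x) = p * Nat.card (zpowers (x ^ p)) := by
  have h1 := hG.dvd_orderOf hx
  rw [Nat.card_zpowers, Nat.card_zpowers, orderOf_pow, Nat.gcd_eq_right h1, Nat.mul_div_cancel' h1]

/-- Two elements of a group are power comparable if one is a power of the other. -/
def PowerComparable {G : Type*} [Group G] (x y : G) : Prop :=
  x ∈ zpowers y ∨ y ∈ zpowers x

theorem PowerComparable.refl (x : G) : PowerComparable x x :=
  Or.inl (mem_zpowers x)

theorem powerComparable_of_mem_zpowers [Finite G] (hG : IsPGroup p G) {x y z : G}
    (hy : y ∈ zpowers x) (hz : z ∈ zpowers x) : PowerComparable y z := by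
  induction hn : orderOf x using Nat.strong_induction_on generalizing x with
  | _ n ih =>
    by_cases h1 : x ∈ zpowers y
    · exact Or.inr ((zpowers_le.2 h1) hz)
    by_cases h2 : x ∈ zpowers z
    · exact Or.inl ((zpowers_le.2 h2) hy)
    have hx : x ≠ 1 := by rintro rfl; exact h1 (one_mem _)
    have h3 := card_zpowers_eq_mul hG hx
    rw [Nat.card_zpowers, Nat.card_zpowers] at h3
    have h4 := orderOf_pos (x ^ p)
    have h5 := (Fact.out : p.Prime).two_le
    exact ih (orderOf (x ^ p)) (by nlinarith) (mem_zpowers_pow_of_mem hG hy h1)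
      (mem_zpowers_pow_of_mem hG hz h2) rfl

theorem zpowers_eq_of_mem_of_orderOf_le [Finite G] {x y : G} (h : x ∈ zpowers y)
    (hle : orderOf y ≤ orderOf x) : zpowers x = zpowers y :=
  Subgroup.eq_of_le_of_card_ge (zpowers_le.2 h) (by simpa [Nat.card_zpowers] using hle)

theorem exists_zpowers_eq [Finite G] (H : Subgroup G)
    (h : ∀ y ∈ H, ∀ z ∈ H, PowerComparable y z) : ∃ x ∈ H, zpowers x = H := by
  obtain ⟨x, hx, hmax⟩ := (Set.toFinite (H : Set G)).exists_maximalFor orderOf _ ⟨1, H.one_mem⟩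
  refine ⟨x, hx, le_antisymm (zpowers_le.2 hx) fun y hy => ?_⟩
  rcases h y hy x hx with h1 | h1
  · exact h1
  · have h2 : orderOf y ≤ orderOf x := hmax hy
      (Nat.le_of_dvd (orderOf_pos y) (orderOf_dvd_of_mem_zpowers h1))
    rw [zpowers_eq_of_mem_of_orderOf_le h1 h2]
    exact mem_zpowers y

theorem mul_card_le_of_lt [Finite G] (hG : IsPGroup p G) {F M : Subgroup G} (h : F < M) :
    p * Nat.card F ≤ Nat.card M := by
  obtain ⟨m, hm⟩ := IsPGroup.iff_card.1 (hG.to_subgroup M)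
  obtain ⟨k, hk⟩ := IsPGroup.iff_card.1 (hG.to_subgroup F)
  have h1 : Nat.card F < Nat.card M := by
    by_contra h2
    exact h.ne (Subgroup.eq_of_le_of_card_ge h.le (not_lt.1 h2))
  have h5 := (Fact.out : p.Prime)
  rw [hm, hk] at h1 ⊢
  have := (Nat.pow_lt_pow_iff_right h5.one_lt).1 h1
  rw [← pow_succ']
  exact Nat.pow_le_pow_right h5.pos this

theorem normalizes_of_card_le [Finite G] (hG : IsPGroup p G) {F M : Subgroup G} (h : F ≤ M)
    (hc : Nat.card M ≤ p * Nat.card F) {x : G} (hx : x ∈ M) : x ∈ normalizer (F : Set G) := by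
  have hM := hG.to_subgroup M
  have h5 := (Fact.out : p.Prime)
  have h6 : F.relIndex M * Nat.card F = Nat.card M := by
    rw [mul_comm, ← relIndex_bot_left, ← relIndex_bot_left]
    exact relIndex_mul_relIndex _ _ _ bot_le h
  have hN : (F.subgroupOf M).Normal := by
    rcases h.eq_or_lt with rfl | hlt
    · rw [subgroupOf_self]; infer_instance
    · apply Subgroup.normal_of_index_eq_minFac_card
      have h7 := mul_card_le_of_lt hG hlt
      have h8 : Nat.card M = p * Nat.card F := le_antisymm hc h7
      have h9 : F.relIndex M = p := by
        rw [h8] at h6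
        exact Nat.eq_of_mul_eq_mul_right Nat.card_pos h6
      obtain ⟨m, hm⟩ := IsPGroup.iff_card.1 hM
      rw [← Subgroup.relIndex, h9, hm, Nat.Prime.pow_minFac h5]
      rintro rfl
      rw [pow_zero, h8] at hm
      exact h5.one_lt.ne' (Nat.eq_one_of_mul_eq_one_right hm)
  exact (Subgroup.normal_subgroupOf_iff_le_normalizer h).1 hN hx

theorem pow_eq_one_of_card_le [Finite G] (hG : IsPGroup p G) {a b : G}
    (hab : closure {a, b} = ⊤) (ha : a ^ p = 1) (hb : b ^ p = 1)
    (hc : Set.ncard {y : G | y ^ p = 1} ≤ p ^ 2) (y : G) : y ^ p = 1 := by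
  have h5 := (Fact.out : p.Prime)
  have hcomm : a * b = b * a := by
    by_cases ha1 : a = 1
    · simp [ha1]
    have : Nontrivial G := ⟨a, 1, ha1⟩
    have := hG.center_nontrivial
    have hZ : p ∣ Nat.card (center G) :=
      (hG.to_subgroup (center G)).card_eq_or_dvd.resolve_left
        (Finite.one_lt_card (α := center G)).ne'
    obtain ⟨⟨z, hzc⟩, hz⟩ := exists_prime_orderOf_dvd_card' p hZ
    rw [Subgroup.orderOf_mk] at hz
    have hzcomm : ∀ g, g * z = z * g := mem_center_iff.1 hzc
    have hoa : orderOf a = p := orderOf_eq_prime ha ha1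
    by_cases hza : z ∈ zpowers a
    · have h1 := zpowers_eq_of_mem_of_orderOf_le hza (by rw [hz, hoa])
      have h2 : a ∈ zpowers z := by rw [h1]; exact mem_zpowers a
      exact (mem_center_iff.1 ((zpowers_le.2 hzc) h2) b).symm
    · let A : Subgroup G := closure {a, z}
      have hAcomm : ∀ g ∈ A, ∀ h ∈ A, g * h = h * g := by
        have := isMulCommutative_closure (k := ({a, z} : Set G)) (by
          rintro x (rfl | rfl) y (rfl | rfl) <;> simp [hzcomm])
        intro g hg h hh
        exact congrArg Subtype.val (this.1.comm ⟨g, hg⟩ ⟨h, hh⟩)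
      have haA : a ∈ A := subset_closure (by simp)
      have hzA : z ∈ A := subset_closure (by simp)
      have hAp : ∀ g ∈ A, g ^ p = 1 := by
        intro g hg
        induction hg using closure_induction with
        | mem x hx =>
          rcases hx with rfl | rfl
          · exact ha
          · rw [← hz]; exact pow_orderOf_eq_one _
        | one => simp
        | mul x y hx hy ihx ihy =>
          rw [(show Commute x y from hAcomm x hx y hy).mul_pow, ihx, ihy, one_mul]
        | inv x hx ih => rw [inv_pow, ih, inv_one]
      have hcard : p ^ 2 ≤ Nat.card A := by
        have := mul_card_le_of_lt hG (F := zpowers a) (M := A)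
          (lt_of_le_of_ne (zpowers_le.2 haA) (by intro h; rw [h] at hza; exact hza hzA))
        rwa [Nat.card_zpowers, hoa, ← sq] at this
      have hAS : (A : Set G) = {y : G | y ^ p = 1} :=
        Set.eq_of_subset_of_ncard_le hAp (hc.trans (by
          rwa [← Nat.card_coe_set_eq]))
      have hbA : b ∈ A := by
        rw [← SetLike.mem_coe, hAS]; exact hb
      exact hAcomm a haA b hbA
  have hT := isMulCommutative_closure (k := ({a, b} : Set G)) (by
    rintro x (rfl | rfl) y (rfl | rfl) <;> simp [hcomm])
  have hTc : ∀ g h : G, g * h = h * g := by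
    intro g h
    exact congrArg Subtype.val (hT.1.comm ⟨g, by simp [hab]⟩ ⟨h, by simp [hab]⟩)
  have hy : y ∈ closure ({a, b} : Set G) := by simp [hab]
  induction hy using closure_induction with
  | mem x hx => rcases hx with rfl | rfl <;> assumption
  | one => simp
  | mul x y hx hy ihx ihy => rw [(show Commute x y from hTc x y).mul_pow, ihx, ihy, one_mul]
  | inv x hx ih => rw [inv_pow, ih, inv_one]

/-- Elements of a `p`-group generated by `a` and `b` have `p`-th power in `F`, provided `F` is
normalized by `a` and `b` and few elements have `p`-th power in `F`. -/
theorem pow_mem_of_card_le [Finite G] (hG : IsPGroup p G) {a b : G} {F : Subgroup G}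
    (haN : a ∈ normalizer (F : Set G)) (hbN : b ∈ normalizer (F : Set G))
    (hFT : F ≤ closure {a, b})
    (ha : a ^ p ∈ F) (hb : b ^ p ∈ F)
    (hc : Set.ncard {y : G | y ∈ closure ({a, b} : Set G) ∧ y ^ p ∈ F} ≤ p ^ 2 * Nat.card F)
    {y : G} (hy : y ∈ closure ({a, b} : Set G)) : y ^ p ∈ F := by
  set T := closure ({a, b} : Set G) with hTdef
  have hTN : T ≤ normalizer (F : Set G) := by
    rw [hTdef, closure_le]
    rintro x (rfl | rfl) <;> assumption
  let N := F.subgroupOf T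
  have hN : N.Normal := (Subgroup.normal_subgroupOf_iff_le_normalizer hFT).2 hTN
  have haT : a ∈ T := subset_closure (by simp)
  have hbT : b ∈ T := subset_closure (by simp)
  have hQ : IsPGroup p (T ⧸ N) := (hG.to_subgroup T).to_quotient N
  have hmk : ∀ t : T, (QuotientGroup.mk t : T ⧸ N) ^ p = 1 ↔ (t : G) ^ p ∈ F := by
    intro t
    rw [← QuotientGroup.mk_pow, QuotientGroup.eq_one_iff]
    simp [N, mem_subgroupOf]
  have hgen : closure {(QuotientGroup.mk ⟨a, haT⟩ : T ⧸ N), QuotientGroup.mk ⟨b, hbT⟩} = ⊤ := by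
    have h1 : closure ({⟨a, haT⟩, ⟨b, hbT⟩} : Set T) = ⊤ := by
      have := Subgroup.closure_closure_coe_preimage (k := ({a, b} : Set G))
      convert this using 2
      ext x
      simp [Subtype.ext_iff]
    have h2 := MonoidHom.map_closure (QuotientGroup.mk' N) ({⟨a, haT⟩, ⟨b, hbT⟩} : Set T)
    rw [h1, Set.image_pair, ← MonoidHom.range_eq_map,
      MonoidHom.range_eq_top.2 (QuotientGroup.mk'_surjective N)] at h2
    exact h2.symm
  have hcount : Set.ncard {q : T ⧸ N | q ^ p = 1} * Nat.card F ≤ p ^ 2 * Nat.card F := by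
    refine le_trans ?_ hc
    have hcF : Nat.card F = Nat.card N :=
      Nat.card_congr (Subgroup.subgroupOfEquivOfLe hFT).symm.toEquiv
    let f : {q : T ⧸ N | q ^ p = 1} × N →
        {y : G | y ∈ T ∧ y ^ p ∈ F} := fun x =>
      ⟨((x.1.1.out * x.2.1 : T) : G), SetLike.coe_mem _, (hmk _).1 (by
        rw [QuotientGroup.mk_mul_of_mem _ x.2.2, QuotientGroup.out_eq']
        exact x.1.2)⟩
    have hf : Function.Injective f := by
      rintro ⟨⟨q, hq⟩, ⟨n, hn⟩⟩ ⟨⟨q', hq'⟩, ⟨n', hn'⟩⟩ h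
      have h0 := congrArg Subtype.val h
      have h1 : (q.out * n : T) = q'.out * n' := Subtype.ext h0
      have h2 : q = q' := by
        have := congrArg (QuotientGroup.mk (s := N)) h1
        rwa [QuotientGroup.mk_mul_of_mem _ hn, QuotientGroup.mk_mul_of_mem _ hn',
          QuotientGroup.out_eq', QuotientGroup.out_eq'] at this
      subst h2
      have h3 := mul_left_cancel h1
      subst h3
      rfl
    have := Nat.card_le_card_of_injective f hf
    rwa [Nat.card_prod, ← hcF, Nat.card_coe_set_eq, Nat.card_coe_set_eq] at this
  exact (hmk ⟨y, hy⟩).1 (pow_eq_one_of_card_le hQ hgen ((hmk _).2 ha) ((hmk _).2 hb)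
    (Nat.le_of_mul_le_mul_right hcount Nat.card_pos) _)

end General

section Abelian

theorem notMem_closure_pair_pow {p : ℕ} [Fact p.Prime] {G : Type*} [CommGroup G]
    (hG : IsPGroup p G) {a b : G} (h : b ∉ zpowers a) :
    b ∉ closure ({a, b ^ p} : Set G) := by
  rw [mem_closure_pair]
  rintro ⟨m, n, hmn⟩
  have h1 : b ^ (1 - (p : ℤ) * n) ∈ zpowers a := by
    rw [zpow_sub, zpow_one, zpow_mul, zpow_natCast, mul_inv_eq_of_eq_mul hmn.symm]
    exact ⟨m, rfl⟩
  refine h (mem_of_zpow_mem hG (fun hd => ?_) h1)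
  have h2 : (p : ℤ) ∣ 1 := by
    have := dvd_add hd (dvd_mul_right (p : ℤ) n)
    rwa [sub_add_cancel] at this
  exact (Fact.out : p.Prime).ne_one (by exact_mod_cast Int.eq_one_of_dvd_one (by positivity) h2)

theorem ncard_torsion_mul_card_map {G : Type*} [CommGroup G] (p : ℕ) (K : Subgroup G) :
    Set.ncard {y : G | y ∈ K ∧ y ^ p = 1} * Nat.card (K.map (powMonoidHom p)) = Nat.card K := by
  let f : K →* G := (powMonoidHom p).comp K.subtype
  have h1 := f.ker.card_mul_index
  rw [index_ker, MonoidHom.range_comp, range_subtype] at h1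
  rw [← h1, ← Nat.card_coe_set_eq]
  congr 1
  refine Nat.card_congr ⟨fun y => ⟨⟨y.1, y.2.1⟩, y.2.2⟩, fun y => ⟨y.1.1, y.1.2, y.2⟩,
    fun _ => rfl, fun _ => rfl⟩

theorem map_pow_closure_pair {G : Type*} [CommGroup G] (p : ℕ) (a b : G) :
    (closure ({a, b} : Set G)).map (powMonoidHom p) = closure {a ^ p, b ^ p} := by
  rw [MonoidHom.map_closure, Set.image_pair]
  rfl

theorem closure_pair_pow_lt {p : ℕ} [Fact p.Prime] {G : Type*} [CommGroup G]
    (hG : IsPGroup p G) {a b : G} (h : b ∉ zpowers a) :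
    closure ({a, b ^ p} : Set G) < closure {a, b} := by
  refine lt_of_le_of_ne ?_ fun h1 => notMem_closure_pair_pow hG h (h1 ▸ subset_closure (by simp))
  rw [closure_le]
  rintro x (rfl | rfl)
  · exact subset_closure (by simp)
  · exact pow_mem (subset_closure (by simp)) p

theorem closure_pow_pair_pow_lt {p : ℕ} [Fact p.Prime] {G : Type*} [CommGroup G]
    (hG : IsPGroup p G) {a b : G} (h : a ∉ zpowers b) :
    closure ({a ^ p, b ^ p} : Set G) < closure {a, b ^ p} := by
  have := closure_pair_pow_lt hG (a := b ^ p) (b := a) fun h1 =>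
    h ((zpowers_le.2 (pow_mem (mem_zpowers b) p)) h1)
  rwa [Set.pair_comm (b ^ p), Set.pair_comm (b ^ p)] at this

variable {p : ℕ} [Fact p.Prime] {G : Type*} [CommGroup G] [Finite G]

theorem card_closure_pair_le (a b : G) :
    Nat.card (closure ({a, b} : Set G)) ≤ p * Nat.card (closure ({a, b ^ p} : Set G)) := by
  have hp := (Fact.out : p.Prime).pos
  have hle : closure ({a, b ^ p} : Set G) ≤ closure {a, b} := by
    rw [closure_le]
    rintro x (rfl | rfl)
    · exact subset_closure (by simp)
    · exact pow_mem (subset_closure (by simp)) p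
  let f : Fin p × closure ({a, b ^ p} : Set G) → closure ({a, b} : Set G) := fun x =>
    ⟨b ^ (x.1 : ℕ) * x.2, mul_mem (pow_mem (subset_closure (by simp)) _) (hle x.2.2)⟩
  have hf : Function.Surjective f := by
    rintro ⟨y, hy⟩
    obtain ⟨m, n, rfl⟩ := mem_closure_pair.1 hy
    have hp0 : (0 : ℤ) < p := by exact_mod_cast hp
    refine ⟨⟨⟨(n % p).toNat, by
      have := Int.emod_lt_of_pos n hp0
      have := Int.emod_nonneg n hp0.ne'
      omega⟩, ⟨a ^ m * (b ^ p) ^ (n / p), mem_closure_pair.2 ⟨m, n / p, rfl⟩⟩⟩, ?_⟩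
    apply Subtype.ext
    have h1 : b ^ (n % p).toNat = b ^ (n % p) := by
      rw [← zpow_natCast, Int.toNat_of_nonneg (Int.emod_nonneg n hp0.ne')]
    have h2 : b ^ n = b ^ (n % p) * (b ^ p) ^ (n / p) := by
      rw [← zpow_natCast b p, ← zpow_mul, ← zpow_add, Int.emod_add_mul_ediv]
    simp only [f]
    rw [h1, h2, mul_left_comm]
  have := Nat.card_le_card_of_surjective f hf
  rwa [Nat.card_prod, Nat.card_fin] at this

theorem card_closure_pair_le_sq (a b : G) :
    Nat.card (closure ({a, b} : Set G)) ≤ p ^ 2 * Nat.card (closure ({a ^ p, b ^ p} : Set G)) := by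
  have h1 := card_closure_pair_le (p := p) a b
  have h2 := card_closure_pair_le (p := p) (b ^ p) a
  rw [Set.pair_comm (b ^ p) a, Set.pair_comm (b ^ p)] at h2
  nlinarith [(Fact.out : p.Prime).pos]

theorem sq_le_ncard_torsion (hG : IsPGroup p G) {a b : G} (h : ¬ PowerComparable a b) :
    p ^ 2 ≤ Set.ncard {y : G | y ∈ closure ({a, b} : Set G) ∧ y ^ p = 1} := by
  rw [PowerComparable, not_or] at h
  have h1 := mul_card_le_of_lt hG (closure_pair_pow_lt hG h.2)
  have h2 := mul_card_le_of_lt hG (closure_pow_pair_pow_lt hG h.1)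
  have h3 := ncard_torsion_mul_card_map p (closure ({a, b} : Set G))
  rw [map_pow_closure_pair p] at h3
  have h4 : 0 < Nat.card (closure ({a ^ p, b ^ p} : Set G)) := Nat.card_pos
  refine Nat.le_of_mul_le_mul_right ?_ h4
  rw [h3]
  nlinarith

theorem ncard_torsion_le_sq (a b : G) :
    Set.ncard {y : G | y ∈ closure ({a, b} : Set G) ∧ y ^ p = 1} ≤ p ^ 2 := by
  have h3 := ncard_torsion_mul_card_map p (closure ({a, b} : Set G))
  rw [map_pow_closure_pair p] at h3
  have h4 : 0 < Nat.card (closure ({a ^ p, b ^ p} : Set G)) := Nat.card_pos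
  refine Nat.le_of_mul_le_mul_right ?_ h4
  rw [h3]
  exact card_closure_pair_le_sq a b

theorem mem_closure_pair_of_pow_mem (hG : IsPGroup p G) {a b y u v : G}
    (h : ¬ PowerComparable a b) (ha : a ∈ closure ({u, v} : Set G))
    (hb : b ∈ closure ({u, v} : Set G)) (hy : y ∈ closure ({u, v} : Set G))
    (hyp : y ^ p ∈ closure ({a ^ p, b ^ p} : Set G)) : y ∈ closure ({a, b} : Set G) := by
  rw [← map_pow_closure_pair p] at hyp
  obtain ⟨g, hg, hgy⟩ := hyp
  have hgy : g ^ p = y ^ p := hgy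
  have hle : closure ({a, b} : Set G) ≤ closure {u, v} := by
    rw [closure_le]
    rintro x (rfl | rfl) <;> assumption
  have heq : {y : G | y ∈ closure ({a, b} : Set G) ∧ y ^ p = 1} =
      {y : G | y ∈ closure ({u, v} : Set G) ∧ y ^ p = 1} :=
    Set.eq_of_subset_of_ncard_le (fun x hx => ⟨hle hx.1, hx.2⟩)
      ((ncard_torsion_le_sq u v).trans (sq_le_ncard_torsion hG h))
  have ht : y * g⁻¹ ∈ {y : G | y ∈ closure ({u, v} : Set G) ∧ y ^ p = 1} :=
    ⟨mul_mem hy (inv_mem (hle hg)), by rw [mul_pow, inv_pow, hgy, mul_inv_cancel]⟩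
  rw [← heq] at ht
  simpa using mul_mem ht.1 hg

theorem exists_torsion_notMem_zpowers (hG : IsPGroup p G) {a b : G}
    (h : ¬ PowerComparable a b) (x : G) : ∃ t : G, t ^ p = 1 ∧ t ∉ zpowers x := by
  by_contra! hcon
  have hp := (Fact.out : p.Prime).two_le
  have h1 : Set.ncard {y : G | y ∈ closure ({a, b} : Set G) ∧ y ^ p = 1} ≤
      Set.ncard {y : G | y ∈ zpowers x ∧ y ^ p = 1} :=
    Set.ncard_le_ncard fun y hy => ⟨hcon y hy.2, hy.2⟩
  have h2 := (sq_le_ncard_torsion hG h).trans h1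
  have h3 := ncard_torsion_mul_card_map p (zpowers x)
  rw [MonoidHom.map_zpowers, powMonoidHom_apply] at h3
  have h4 : Nat.card (zpowers x) ≤ p * Nat.card (zpowers (x ^ p)) := by
    by_cases hx : x = 1
    · subst hx
      simp only [one_pow]
      exact Nat.le_mul_of_pos_left _ (by omega)
    · exact (card_zpowers_eq_mul hG hx).le
  rw [← h3] at h4
  have := Nat.le_of_mul_le_mul_right h4 Nat.card_pos
  nlinarith

theorem zpowers_eq_of_twins (hG : IsPGroup p G) {a b : G} (h : ¬ PowerComparable a b) {x y : G}
    (hxy : ∀ z, PowerComparable x z ↔ PowerComparable y z) : zpowers x = zpowers y := by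
  wlog hyx : y ∈ zpowers x generalizing x y
  · have h1 : PowerComparable x y := (hxy y).2 (PowerComparable.refl y)
    exact (this (fun z => (hxy z).symm) (h1.resolve_right hyx)).symm
  by_contra hne
  have hx : x ∉ zpowers y := fun h1 => hne (le_antisymm (zpowers_le.2 h1) (zpowers_le.2 hyx))
  have hyp := mem_zpowers_pow_of_mem hG hyx hx
  obtain ⟨t, ht, htx⟩ := exists_torsion_notMem_zpowers hG h x
  have hx1 : x ≠ 1 := by rintro rfl; exact hx (one_mem _)
  have hyz : y ∈ zpowers (x * t) := by
    have h1 : x ^ p = (x * t) ^ p := by rw [mul_pow, ht, mul_one]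
    rw [h1] at hyp
    exact (zpowers_le.2 (pow_mem (mem_zpowers _) p)) hyp
  rcases (hxy (x * t)).2 (Or.inl hyz) with h1 | h1
  · have h2 : t ∈ zpowers (x * t) := by
      simpa using mul_mem (inv_mem h1) (mem_zpowers (x * t))
    rcases powerComparable_of_mem_zpowers hG h2 h1 with h3 | h3
    · exact htx h3
    · have h4 := zpowers_eq_of_mem_of_orderOf_le h3 ((orderOf_le_of_pow_eq_one
        (Fact.out : p.Prime).pos ht).trans (Nat.le_of_dvd (orderOf_pos x) (hG.dvd_orderOf hx1)))
      exact htx (h4 ▸ mem_zpowers t)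
  · exact htx (by simpa using mul_mem (inv_mem (mem_zpowers x)) h1)

end Abelian

section PowerGraph

variable {p : ℕ} [Fact p.Prime]

theorem ncard_generators_add {G : Type*} [Group G] [Finite G] (hG : IsPGroup p G)
    {w : G} (hw : w ≠ 1) :
    Set.ncard {x : G | zpowers x = zpowers w} + Nat.card (zpowers (w ^ p)) =
      p * Nat.card (zpowers (w ^ p)) := by
  rw [← card_zpowers_eq_mul hG hw]
  have h1 : {x : G | zpowers x = zpowers w} =
      (zpowers w : Set G) \ (zpowers (w ^ p) : Set G) := by
    ext x
    constructor
    · intro hx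
      have hx : zpowers x = zpowers w := hx
      refine ⟨hx ▸ mem_zpowers x, fun hxp => hw (eq_one_of_mem_zpowers_pow hG ?_)⟩
      exact (zpowers_le.2 hxp) (hx ▸ mem_zpowers w)
    · rintro ⟨hx, hxp⟩
      by_contra hne
      refine hxp (mem_zpowers_pow_of_mem hG hx fun h => hne ?_)
      exact le_antisymm (zpowers_le.2 hx) (zpowers_le.2 h)
  have h2 : (zpowers (w ^ p) : Set G) ⊆ zpowers w :=
    SetLike.coe_subset_coe.2 (zpowers_le.2 (pow_mem (mem_zpowers w) p))
  rw [h1]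
  exact Set.ncard_sdiff_add_ncard_of_subset h2

theorem twins_of_zpowers_eq {G : Type*} [Group G] {x y : G} (h : zpowers x = zpowers y) (z : G) :
    PowerComparable x z ↔ PowerComparable y z := by
  have h1 : x ∈ zpowers z ↔ y ∈ zpowers z := by rw [← zpowers_le, h, zpowers_le]
  rw [PowerComparable, PowerComparable, h, h1]

theorem twins_of_between {G : Type*} [Group G] [Finite G] (hG : IsPGroup p G) {u v w : G}
    (huv : ∀ z, PowerComparable u z ↔ PowerComparable v z) (hvw : v ∈ zpowers w)
    (hwu : w ∈ zpowers u) (z : G) : PowerComparable u z ↔ PowerComparable w z := by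
  constructor
  · rintro (h | h)
    · exact Or.inl ((zpowers_le.2 h) hwu)
    · exact powerComparable_of_mem_zpowers hG hwu h
  · rintro (h | h)
    · exact (huv z).2 (Or.inl ((zpowers_le.2 h) hvw))
    · exact Or.inr ((zpowers_le.2 hwu) h)

variable {G₁ G₂ : Type*} [CommGroup G₁] [Finite G₁] [Group G₂] [Finite G₂]

theorem zpowers_apply_eq_iff (hG₁ : IsPGroup p G₁) (hG₂ : IsPGroup p G₂) {a b : G₁}
    (hab : ¬ PowerComparable a b) (φ : G₁ ≃ G₂) (h1 : φ 1 = 1)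
    (hφ : ∀ x y, PowerComparable x y ↔ PowerComparable (φ x) (φ y)) (u v : G₁) :
    zpowers u = zpowers v ↔ zpowers (φ u) = zpowers (φ v) := by
  have htw : ∀ x y : G₁, (∀ z, PowerComparable (φ x) z ↔ PowerComparable (φ y) z) ↔
      zpowers x = zpowers y := by
    refine fun x y => ⟨fun h => zpowers_eq_of_twins hG₁ hab fun z => ?_, fun h z => ?_⟩
    · rw [hφ, hφ y]; exact h _
    · obtain ⟨z, rfl⟩ := φ.surjective z
      rw [← hφ, ← hφ]; exact twins_of_zpowers_eq h z
  refine ⟨fun huv => ?_, fun h => (htw u v).1 (twins_of_zpowers_eq h)⟩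
  by_cases hu1 : u = 1
  · subst hu1
    rw [zpowers_one_eq_bot, eq_comm, zpowers_eq_bot] at huv
    rw [huv]
  set C : Set G₁ := {x | zpowers x = zpowers u} with hC
  obtain ⟨w, hw, hmax⟩ := (Set.toFinite C).exists_maximalFor (fun x => orderOf (φ x)) _ ⟨u, rfl⟩
  suffices H : ∀ x ∈ C, zpowers (φ x) = zpowers (φ w) by
    rw [H u rfl, H v huv.symm]
  have hw1 : w ≠ 1 := by
    rintro rfl
    rw [hC, Set.mem_ofPred_eq, zpowers_one_eq_bot, eq_comm, zpowers_eq_bot] at hw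
    exact hu1 hw
  have hC1 : ∀ x ∈ C, φ x ≠ 1 := by
    intro x hx hx1
    rw [← h1] at hx1
    have := φ.injective hx1
    subst this
    rw [hC, Set.mem_ofPred_eq, zpowers_one_eq_bot, eq_comm, zpowers_eq_bot] at hx
    exact hu1 hx
  have hCw : ∀ x ∈ C, zpowers x = zpowers w := fun x hx => Eq.trans hx hw.symm
  have hmem : ∀ x ∈ C, φ x ∈ zpowers (φ w) := by
    intro x hx
    have h2 := ((htw x w).2 (hCw x hx) (φ w)).2 (PowerComparable.refl _)
    rcases h2 with h2 | h2
    · exact h2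
    · have h3 : orderOf (φ x) ≤ orderOf (φ w) := hmax hx
        (Nat.le_of_dvd (orderOf_pos _) (orderOf_dvd_of_mem_zpowers h2))
      rw [zpowers_eq_of_mem_of_orderOf_le h2 h3]
      exact mem_zpowers _
  intro x hx
  by_contra hne
  have hxp : φ x ∈ zpowers (φ w ^ p) := mem_zpowers_pow_of_mem hG₂ (hmem x hx) fun h =>
    hne (le_antisymm (zpowers_le.2 (hmem x hx)) (zpowers_le.2 h))
  have hwp : φ w ^ p ≠ 1 := by
    intro h
    rw [h, zpowers_one_eq_bot, mem_bot] at hxp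
    exact hC1 x hx hxp
  have hlow : ((zpowers (φ w) : Set G₂) \ zpowers ((φ w ^ p) ^ p)) ⊆ φ '' C := by
    rintro y ⟨hy, hyp⟩
    obtain ⟨y, rfl⟩ := φ.surjective y
    have h2 : φ w ^ p ∈ zpowers (φ y) := by
      rcases powerComparable_of_mem_zpowers hG₂ hy (pow_mem (mem_zpowers (φ w)) p) with h3 | h3
      · by_contra h4
        exact hyp (mem_zpowers_pow_of_mem hG₂ h3 h4)
      · exact h3
    have h3 := twins_of_between hG₂ ((htw w x).2 (hCw x hx).symm) ((zpowers_le.2 h2) hxp) hy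
    exact ⟨y, ((htw w y).1 h3).symm.trans hw, rfl⟩
  have hup : φ '' C ⊆ (zpowers (φ w) : Set G₂) \ {1} := by
    rintro _ ⟨y, hy, rfl⟩
    exact ⟨hmem y hy, hC1 y hy⟩
  have hlow' := Set.ncard_le_ncard hlow
  have hup' := Set.ncard_le_ncard hup
  rw [Set.ncard_image_of_injective _ φ.injective] at hlow' hup'
  have hsub : (zpowers ((φ w ^ p) ^ p) : Set G₂) ⊆ zpowers (φ w) :=
    SetLike.coe_subset_coe.2 (zpowers_le.2 (pow_mem (pow_mem (mem_zpowers _) p) p))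
  have e1 : Set.ncard ((zpowers (φ w) : Set G₂) \ zpowers ((φ w ^ p) ^ p)) +
      Nat.card (zpowers ((φ w ^ p) ^ p)) = Nat.card (zpowers (φ w)) :=
    Set.ncard_sdiff_add_ncard_of_subset hsub
  have e2 : Set.ncard ((zpowers (φ w) : Set G₂) \ {1}) + 1 = Nat.card (zpowers (φ w)) := by
    have := Set.ncard_sdiff_add_ncard_of_subset (s := {(1 : G₂)}) (t := (zpowers (φ w) : Set G₂))
      (by simp)
    rwa [Set.ncard_singleton] at this
  have e3 := card_zpowers_eq_mul hG₂ (hC1 w hw)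
  have e4 := card_zpowers_eq_mul hG₂ hwp
  have e5 := ncard_generators_add hG₁ hu1
  obtain ⟨k, hk⟩ := IsPGroup.iff_card.1 (hG₁.to_subgroup (zpowers (u ^ p)))
  obtain ⟨l, hl⟩ := IsPGroup.iff_card.1 (hG₂.to_subgroup (zpowers ((φ w ^ p) ^ p)))
  have hp := (Fact.out : p.Prime)
  rw [hk] at e5
  rw [e4, hl] at e3
  rw [hl, e3] at e1
  rw [e3] at e2
  change C.ncard + p ^ k = p * p ^ k at e5
  have hp2 := hp.two_le
  have hn : p ^ k < p ^ (l + 2) := by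
    have : p ^ (l + 2) = p * (p * p ^ l) := by ring
    rw [this]
    nlinarith [Nat.zero_le (p ^ k)]
  have hkl : k ≤ l + 1 := by
    have := (Nat.pow_lt_pow_iff_right hp.one_lt).1 hn
    omega
  have hn2 : p ^ k ≤ p * p ^ l := by
    rw [← pow_succ']
    exact Nat.pow_le_pow_right hp.pos hkl
  have hl0 : 0 < p ^ l := Nat.pow_pos hp.pos
  obtain ⟨q, rfl⟩ : ∃ q, p = q + 2 := ⟨p - 2, by omega⟩
  nlinarith

theorem mem_zpowers_apply_iff (hG₁ : IsPGroup p G₁) (hG₂ : IsPGroup p G₂) {a b : G₁}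
    (hab : ¬ PowerComparable a b) (φ : G₁ ≃ G₂) (h1 : φ 1 = 1)
    (hφ : ∀ x y, PowerComparable x y ↔ PowerComparable (φ x) (φ y)) (x y : G₁) :
    x ∈ zpowers y ↔ φ x ∈ zpowers (φ y) := by
  have hz := zpowers_apply_eq_iff hG₁ hG₂ hab φ h1 hφ
  have hp := (Fact.out : p.Prime).two_le
  have hord : ∀ w, orderOf (φ w) = orderOf w := by
    intro w
    by_cases hw : w = 1
    · rw [hw, h1, orderOf_one, orderOf_one]
    have hw' : φ w ≠ 1 := fun h => hw (φ.injective (h.trans h1.symm))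
    have e1 := ncard_generators_add hG₁ hw
    have e2 := ncard_generators_add hG₂ hw'
    have e3 : {y : G₂ | zpowers y = zpowers (φ w)} = φ '' {x : G₁ | zpowers x = zpowers w} := by
      ext y
      obtain ⟨y, rfl⟩ := φ.surjective y
      simp [← hz]
    rw [e3, Set.ncard_image_of_injective _ φ.injective] at e2
    have e4 : Nat.card (zpowers (φ w ^ p)) = Nat.card (zpowers (w ^ p)) := by
      obtain ⟨q, rfl⟩ : ∃ q, p = q + 2 := ⟨p - 2, by omega⟩
      have e5 : (q + 1) * Nat.card (zpowers (φ w ^ (q + 2))) =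
          (q + 1) * Nat.card (zpowers (w ^ (q + 2))) := by linarith
      exact Nat.eq_of_mul_eq_mul_left (by omega) e5
    rw [← Nat.card_zpowers, ← Nat.card_zpowers, card_zpowers_eq_mul hG₁ hw,
      card_zpowers_eq_mul hG₂ hw', e4]
  constructor
  · intro h
    rcases (hφ x y).1 (Or.inl h) with h2 | h2
    · exact h2
    · rw [zpowers_eq_of_mem_of_orderOf_le h2 (by
        rw [hord, hord]
        exact Nat.le_of_dvd (orderOf_pos _) (orderOf_dvd_of_mem_zpowers h))]
      exact mem_zpowers _
  · intro h
    rcases (hφ x y).2 (Or.inl h) with h2 | h2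
    · exact h2
    · rw [zpowers_eq_of_mem_of_orderOf_le h2 (by
        rw [← hord, ← hord y]
        exact Nat.le_of_dvd (orderOf_pos _) (orderOf_dvd_of_mem_zpowers h))]
      exact mem_zpowers _

theorem apply_pow_mem {A B : Type*} [Group A] [Group B] (hA : IsPGroup p A) (hB : IsPGroup p B)
    (φ : A ≃ B) (h1 : φ 1 = 1) (hφ : ∀ x y, x ∈ zpowers y ↔ φ x ∈ zpowers (φ y)) (x : A) :
    φ (x ^ p) ∈ zpowers (φ x ^ p) := by
  by_contra h
  have h2 : φ (x ^ p) ∈ zpowers (φ x) := (hφ _ _).1 (pow_mem (mem_zpowers x) p)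
  have h3 : φ x ∈ zpowers (φ (x ^ p)) := by
    by_contra h3
    exact h (mem_zpowers_pow_of_mem hB h2 h3)
  have h4 := eq_one_of_mem_zpowers_pow hA ((hφ _ _).2 h3)
  subst h4
  simp [h1] at h

end PowerGraph

section LatticeIso

variable {p : ℕ} [Fact p.Prime]
  {G₁ G₂ : Type*} [CommGroup G₁] [Finite G₁] [Group G₂] [Finite G₂]

theorem closure_pair_eq_zpowers {G : Type*} [Group G] {a b : G} (h : a ∈ zpowers b) :
    closure ({a, b} : Set G) = zpowers b := by
  refine le_antisymm ?_ (zpowers_le.2 (subset_closure (by simp)))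
  rw [closure_le]
  rintro x (rfl | rfl)
  · exact h
  · exact mem_zpowers x

theorem image_zpowers {A B : Type*} [Group A] [Group B] (φ : A ≃ B)
    (hφ : ∀ x y, x ∈ zpowers y ↔ φ x ∈ zpowers (φ y)) (x : A) :
    φ '' (zpowers x : Set A) = zpowers (φ x) := by
  ext y
  obtain ⟨y, rfl⟩ := φ.surjective y
  simp [← hφ]

theorem image_closure_pair (hG₁ : IsPGroup p G₁) (hG₂ : IsPGroup p G₂) (φ : G₁ ≃ G₂)
    (h1 : φ 1 = 1) (hφ : ∀ x y, x ∈ zpowers y ↔ φ x ∈ zpowers (φ y))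
    (hQ : ∀ a b y, φ y ∈ closure ({φ a, φ b} : Set G₂) → ∃ u v,
      a ∈ closure ({u, v} : Set G₁) ∧ b ∈ closure ({u, v} : Set G₁) ∧
        y ∈ closure ({u, v} : Set G₁)) (a b : G₁) :
    φ '' (closure ({a, b} : Set G₁) : Set G₁) = closure ({φ a, φ b} : Set G₂) := by
  induction hn : Nat.card (closure ({a, b} : Set G₁)) using Nat.strong_induction_on
    generalizing a b with
  | _ n ih =>
    by_cases hab : PowerComparable a b
    · rcases hab with h | h
      · rw [closure_pair_eq_zpowers h, closure_pair_eq_zpowers ((hφ _ _).1 h),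
          image_zpowers φ hφ]
      · rw [Set.pair_comm, Set.pair_comm (φ a), closure_pair_eq_zpowers h,
          closure_pair_eq_zpowers ((hφ _ _).1 h), image_zpowers φ hφ]
    have hab' := hab
    rw [PowerComparable, not_or] at hab'
    have hp := (Fact.out : p.Prime).pos
    have hcard : ∀ {K : Subgroup G₁} {L : Subgroup G₂}, φ '' (K : Set G₁) = L →
        Nat.card K = Nat.card L := by
      intro K L h
      have h2 := Set.ncard_image_of_injective (K : Set G₁) φ.injective
      rw [h] at h2
      exact h2.symm
    have hlt : ∀ {K L : Subgroup G₁}, K < L → Nat.card K < Nat.card L := by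
      intro K L h
      by_contra h2
      exact h.ne (Subgroup.eq_of_le_of_card_ge h.le (not_lt.1 h2))
    have hMlt := closure_pair_pow_lt hG₁ hab'.2
    have hFlt := closure_pow_pair_pow_lt hG₁ hab'.1
    have hNlt : closure ({a ^ p, b} : Set G₁) < closure {a, b} := by
      rw [Set.pair_comm, Set.pair_comm a]
      exact closure_pair_pow_lt hG₁ hab'.1
    have hM := ih _ (hn ▸ hlt hMlt) a (b ^ p) rfl
    have hN := ih _ (hn ▸ hlt hNlt) (a ^ p) b rfl
    have hF := ih _ (hn ▸ hlt (hFlt.trans hMlt)) (a ^ p) (b ^ p) rfl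
    set F := closure ({a ^ p, b ^ p} : Set G₁)
    set F' := closure ({φ (a ^ p), φ (b ^ p)} : Set G₂)
    set T := closure ({φ a, φ b} : Set G₂) with hT
    have hpow : ∀ x, φ (x ^ p) ∈ zpowers (φ x) := fun x =>
      (hφ _ _).1 (pow_mem (mem_zpowers x) p)
    have haT : φ a ∈ T := subset_closure (by simp)
    have hbT : φ b ∈ T := subset_closure (by simp)
    have hpow' : ∀ x, φ x ^ p ∈ zpowers (φ (x ^ p)) := by
      intro x
      have h2 := apply_pow_mem hG₂ hG₁ φ.symm (by rw [Equiv.symm_apply_eq, h1])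
        (fun x y => by rw [hφ]; simp) (φ x)
      rw [Equiv.symm_apply_apply, hφ] at h2
      simpa using h2
    have hFM : F' ≤ closure {φ a, φ (b ^ p)} := by
      rw [← SetLike.coe_subset_coe, ← hM, ← hF]
      exact Set.image_mono hFlt.le
    have hFN : F' ≤ closure {φ (a ^ p), φ b} := by
      rw [closure_le]
      rintro x (rfl | rfl)
      · exact subset_closure (by simp)
      · exact (zpowers_le.2 (subset_closure (by simp))) (hpow b)
    have hMT : closure {φ a, φ (b ^ p)} ≤ T := by
      rw [closure_le]
      rintro x (rfl | rfl)
      · exact haT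
      · exact (zpowers_le.2 hbT) (hpow b)
    have haN : φ a ∈ normalizer (F' : Set G₂) := by
      refine normalizes_of_card_le hG₂ hFM ?_ (subset_closure (by simp))
      rw [← hcard hM, ← hcard hF]
      have h2 := card_closure_pair_le (p := p) (b ^ p) a
      rwa [Set.pair_comm, Set.pair_comm (b ^ p)] at h2
    have hbN : φ b ∈ normalizer (F' : Set G₂) := by
      refine normalizes_of_card_le hG₂ hFN ?_ (subset_closure (by simp))
      rw [← hcard hN, ← hcard hF]
      exact card_closure_pair_le (p := p) (a ^ p) b
    have hsub : {y : G₂ | y ∈ T ∧ y ^ p ∈ F'} ⊆ φ '' (closure ({a, b} : Set G₁) : Set G₁) := by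
      rintro y ⟨hyT, hyF⟩
      obtain ⟨y, rfl⟩ := φ.surjective y
      have h2 := (zpowers_le.2 hyF) (apply_pow_mem hG₁ hG₂ φ h1 hφ y)
      rw [← SetLike.mem_coe, ← hF, φ.injective.mem_set_image] at h2
      obtain ⟨u, v, hu, hv, hy⟩ := hQ a b y hyT
      exact ⟨y, mem_closure_pair_of_pow_mem hG₁ hab hu hv hy h2, rfl⟩
    have hle := card_closure_pair_le_sq (p := p) a b
    have hTF : ∀ y ∈ T, y ^ p ∈ F' := by
      intro y hy
      refine pow_mem_of_card_le hG₂ haN hbN (hFM.trans hMT) ?_ ?_ ?_ hy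
      · exact (zpowers_le.2 (subset_closure (by simp))) (hpow' a)
      · exact (zpowers_le.2 (subset_closure (by simp))) (hpow' b)
      · refine (Set.ncard_le_ncard hsub).trans ?_
        rw [Set.ncard_image_of_injective _ φ.injective, ← hcard hF]
        exact hle
    symm
    refine Set.eq_of_subset_of_ncard_le (fun y hy => hsub ⟨hy, hTF y hy⟩) ?_
    rw [Set.ncard_image_of_injective _ φ.injective]
    have hMlt' : closure {φ a, φ (b ^ p)} < T := by
      refine lt_of_le_of_ne hMT fun h => ?_
      have h2 : φ b ∈ (closure {φ a, φ (b ^ p)} : Set G₂) := h ▸ hbT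
      rw [← hM, φ.injective.mem_set_image] at h2
      exact notMem_closure_pair_pow hG₁ hab'.2 h2
    have h3 := mul_card_le_of_lt hG₂ hMlt'
    have h4 := mul_card_le_of_lt hG₁ hFlt
    rw [← hcard hM] at h3
    change Nat.card (closure ({a, b} : Set G₁)) ≤ Nat.card T
    nlinarith

/-- A bijection matching the subgroups generated by two elements induces an isomorphism of
subgroup lattices. -/
def orderIsoOfImageClosurePair {A B : Type*} [Group A] [Group B] (φ : A ≃ B) (h1 : φ 1 = 1)
    (h : ∀ a b, φ '' (closure ({a, b} : Set A) : Set A) = closure ({φ a, φ b} : Set B)) :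
    Subgroup A ≃o Subgroup B where
  toFun K :=
    { carrier := φ '' K
      one_mem' := ⟨1, K.one_mem, h1⟩
      mul_mem' := by
        rintro _ _ ⟨a, ha, rfl⟩ ⟨b, hb, rfl⟩
        have h2 : φ a * φ b ∈ (closure ({φ a, φ b} : Set B) : Set B) :=
          mul_mem (subset_closure (by simp)) (subset_closure (by simp))
        rw [← h] at h2
        exact Set.image_mono ((closure_le K).2 (by rintro x (rfl | rfl) <;> assumption)) h2
      inv_mem' := by
        rintro _ ⟨a, ha, rfl⟩
        have h2 : (φ a)⁻¹ ∈ (closure ({φ a, φ a} : Set B) : Set B) :=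
          inv_mem (subset_closure (by simp))
        rw [← h] at h2
        exact Set.image_mono ((closure_le K).2 (by rintro x (rfl | rfl) <;> assumption)) h2 }
  invFun L :=
    { carrier := φ ⁻¹' L
      one_mem' := by simp [h1]
      mul_mem' := by
        intro a b ha hb
        have h2 : φ (a * b) ∈ φ '' (closure ({a, b} : Set A) : Set A) :=
          ⟨_, mul_mem (subset_closure (by simp)) (subset_closure (by simp)), rfl⟩
        rw [h] at h2
        exact (closure_le L).2 (by rintro x (rfl | rfl) <;> assumption) h2
      inv_mem' := by
        intro a ha
        have h2 : φ a⁻¹ ∈ φ '' (closure ({a, a} : Set A) : Set A) :=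
          ⟨_, inv_mem (subset_closure (by simp)), rfl⟩
        rw [h] at h2
        exact (closure_le L).2 (by rintro x (rfl | rfl) <;> assumption) h2 }
  left_inv K := SetLike.coe_injective (φ.injective.preimage_image _)
  right_inv L := SetLike.coe_injective (φ.surjective.image_preimage _)
  map_rel_iff' := by
    intro K L
    exact Set.image_subset_image_iff φ.injective

theorem nonempty_subgroup_orderIso (hG₁ : IsPGroup p G₁) (hG₂ : IsPGroup p G₂) (φ : G₁ ≃ G₂)
    (h1 : φ 1 = 1) (hφ : ∀ x y, PowerComparable x y ↔ PowerComparable (φ x) (φ y))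
    (hQ : ∀ a b y, φ y ∈ closure ({φ a, φ b} : Set G₂) → ∃ u v,
      a ∈ closure ({u, v} : Set G₁) ∧ b ∈ closure ({u, v} : Set G₁) ∧
        y ∈ closure ({u, v} : Set G₁)) :
    Nonempty (Subgroup G₁ ≃o Subgroup G₂) := by
  by_cases hall : ∀ a b : G₁, PowerComparable a b
  · have hall' : ∀ a b : G₂, PowerComparable a b := by
      intro a b
      have := (hφ (φ.symm a) (φ.symm b)).1 (hall _ _)
      simpa using this
    obtain ⟨x, -, hx⟩ := exists_zpowers_eq (⊤ : Subgroup G₁) fun y _ z _ => hall y z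
    obtain ⟨x', -, hx'⟩ := exists_zpowers_eq (⊤ : Subgroup G₂) fun y _ z _ => hall' y z
    have : IsCyclic G₁ := ⟨x, fun y => by change y ∈ zpowers x; rw [hx]; exact mem_top y⟩
    have : IsCyclic G₂ := ⟨x', fun y => by change y ∈ zpowers x'; rw [hx']; exact mem_top y⟩
    exact ⟨(mulEquivOfCyclicCardEq (Nat.card_congr φ)).mapSubgroup⟩
  · push Not at hall
    obtain ⟨a, b, hab⟩ := hall
    exact ⟨orderIsoOfImageClosurePair φ h1 (image_closure_pair hG₁ hG₂ φ h1
      (mem_zpowers_apply_iff hG₁ hG₂ hab φ h1 hφ) hQ)⟩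

end LatticeIso

section OfOrderIso

variable {p : ℕ} [Fact p.Prime] {G₁ G₂ : Type*} [Group G₁] [Finite G₁] [Group G₂] [Finite G₂]

theorem exists_zpowers_eq_of_le {G : Type*} [Group G] [Finite G] (hG : IsPGroup p G) {x : G}
    {K : Subgroup G} (h : K ≤ zpowers x) : ∃ y, zpowers y = K := by
  obtain ⟨y, -, hy⟩ := exists_zpowers_eq K fun y hy z hz =>
    powerComparable_of_mem_zpowers hG (h hy) (h hz)
  exact ⟨y, hy⟩

theorem exists_zpowers_eq_orderIso (hG₁ : IsPGroup p G₁) (f : Subgroup G₁ ≃o Subgroup G₂)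
    (x : G₁) : ∃ y, zpowers y = f (zpowers x) := by
  obtain ⟨y, -, hy⟩ := exists_zpowers_eq (f (zpowers x)) fun y hy z hz => by
    have h1 : ∀ w ∈ f (zpowers x), ∃ v ∈ zpowers x, f (zpowers v) = zpowers w := by
      intro w hw
      have h2 : f.symm (zpowers w) ≤ zpowers x := by
        rw [f.symm_apply_le]; exact zpowers_le.2 hw
      obtain ⟨v, hv⟩ := exists_zpowers_eq_of_le hG₁ h2
      exact ⟨v, h2 (hv ▸ mem_zpowers v), by rw [hv, f.apply_symm_apply]⟩
    obtain ⟨v, hv, hvy⟩ := h1 y hy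
    obtain ⟨w, hw, hwz⟩ := h1 z hz
    rcases powerComparable_of_mem_zpowers hG₁ hv hw with h | h
    · left
      rw [← zpowers_le, ← hvy, ← hwz, f.le_iff_le]
      exact zpowers_le.2 h
    · right
      rw [← zpowers_le, ← hvy, ← hwz, f.le_iff_le]
      exact zpowers_le.2 h
  exact ⟨y, hy⟩

theorem zpowers_pow_le_of_orderIso (hG₁ : IsPGroup p G₁) (hG₂ : IsPGroup p G₂)
    (f : Subgroup G₁ ≃o Subgroup G₂) {x : G₁} {y : G₂} (h : zpowers y = f (zpowers x))
    (hx : x ≠ 1) : f (zpowers (x ^ p)) ≤ zpowers (y ^ p) := by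
  obtain ⟨w, hw⟩ := exists_zpowers_eq_orderIso hG₁ f (x ^ p)
  rw [← hw, zpowers_le]
  refine mem_zpowers_pow_of_mem hG₂ ?_ fun hy => hx (eq_one_of_mem_zpowers_pow hG₁ ?_)
  · rw [← zpowers_le, h, hw, f.le_iff_le, zpowers_le]
    exact pow_mem (mem_zpowers x) p
  · rw [← zpowers_le, ← f.le_iff_le, ← hw, ← h, zpowers_le]
    exact hy

theorem orderOf_eq_of_orderIso (hG₁ : IsPGroup p G₁) (hG₂ : IsPGroup p G₂)
    (f : Subgroup G₁ ≃o Subgroup G₂) {x : G₁} {y : G₂} (h : zpowers y = f (zpowers x)) :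
    orderOf x = orderOf y := by
  induction hn : orderOf x using Nat.strong_induction_on generalizing x y with
  | _ n ih =>
    subst hn
    by_cases hx : x = 1
    · subst hx
      rw [zpowers_one_eq_bot, f.map_bot, zpowers_eq_bot] at h
      rw [h, orderOf_one, orderOf_one]
    have hy : y ≠ 1 := by
      rintro rfl
      rw [zpowers_one_eq_bot, ← f.map_bot] at h
      exact hx (zpowers_eq_bot.1 (f.injective h).symm)
    have h1 : zpowers (y ^ p) = f (zpowers (x ^ p)) := by
      refine le_antisymm ?_ (zpowers_pow_le_of_orderIso hG₁ hG₂ f h hx)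
      rw [← f.symm_apply_le]
      exact zpowers_pow_le_of_orderIso hG₂ hG₁ f.symm (by rw [h, f.symm_apply_apply]) hy
    have e1 := card_zpowers_eq_mul hG₁ hx
    have e2 := card_zpowers_eq_mul hG₂ hy
    simp only [Nat.card_zpowers] at e1 e2
    have hp := (Fact.out : p.Prime).two_le
    have h0 := orderOf_pos (x ^ p)
    rw [e1, e2, ih _ (by nlinarith) h1 rfl]

theorem ncard_generators_eq (hG₁ : IsPGroup p G₁) (hG₂ : IsPGroup p G₂) {x : G₁} {y : G₂}
    (h : orderOf x = orderOf y) :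
    Set.ncard {w : G₁ | zpowers w = zpowers x} = Set.ncard {w : G₂ | zpowers w = zpowers y} := by
  by_cases hx : x = 1
  · subst hx
    have hy : y = 1 := by rwa [orderOf_one, eq_comm, orderOf_eq_one_iff] at h
    subst hy
    simp [zpowers_one_eq_bot, zpowers_eq_bot]
  have hy : y ≠ 1 := by
    rintro rfl
    rw [orderOf_one, orderOf_eq_one_iff] at h
    exact hx h
  have e1 := ncard_generators_add hG₁ hx
  have e2 := ncard_generators_add hG₂ hy
  have e3 := card_zpowers_eq_mul hG₁ hx
  have e4 := card_zpowers_eq_mul hG₂ hy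
  rw [Nat.card_zpowers x, h, ← Nat.card_zpowers, e4] at e3
  rw [Nat.eq_of_mul_eq_mul_left (Fact.out : p.Prime).pos e3] at e2
  omega

theorem exists_equiv_of_orderIso (hG₁ : IsPGroup p G₁) (hG₂ : IsPGroup p G₂)
    (f : Subgroup G₁ ≃o Subgroup G₂) : ∃ φ : G₁ ≃ G₂, ∀ x, zpowers (φ x) = f (zpowers x) := by
  have key : ∀ c : Subgroup G₂,
      Nonempty ({a : G₁ // f (zpowers a) = c} ≃ {b : G₂ // zpowers b = c}) := by
    intro c
    by_cases hc : ∃ a, f (zpowers a) = c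
    · obtain ⟨a, rfl⟩ := hc
      obtain ⟨b, hb⟩ := exists_zpowers_eq_orderIso hG₁ f a
      have h1 := ncard_generators_eq hG₁ hG₂ (orderOf_eq_of_orderIso hG₁ hG₂ f hb)
      rw [hb] at h1
      simp only [EmbeddingLike.apply_eq_iff_eq]
      exact Finite.card_eq.1 h1
    · have : IsEmpty {a : G₁ // f (zpowers a) = c} := ⟨fun a => hc ⟨a.1, a.2⟩⟩
      have : IsEmpty {b : G₂ // zpowers b = c} := by
        refine ⟨fun b => ?_⟩
        obtain ⟨a, ha⟩ := exists_zpowers_eq_orderIso hG₂ f.symm b.1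
        exact hc ⟨a, by rw [ha, f.apply_symm_apply, b.2]⟩
      exact ⟨Equiv.equivOfIsEmpty _ _⟩
  exact ⟨Equiv.ofFiberEquiv fun c => (key c).some, fun x => Equiv.ofFiberEquiv_map _ x⟩

end OfOrderIso

section Transfer

variable {G₁ G₂ : Type*} [Group G₁] [Group G₂] {f : Subgroup G₁ ≃o Subgroup G₂} {φ : G₁ ≃ G₂}

theorem apply_mem_orderIso_iff (h : ∀ x, zpowers (φ x) = f (zpowers x)) {x : G₁}
    {K : Subgroup G₁} : φ x ∈ f K ↔ x ∈ K := by
  rw [← zpowers_le, h, f.le_iff_le, zpowers_le]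

theorem closure_image_eq (h : ∀ x, zpowers (φ x) = f (zpowers x)) (X : Set G₁) :
    closure (φ '' X) = f (closure X) := by
  apply le_antisymm
  · rw [closure_le]
    rintro _ ⟨x, hx, rfl⟩
    exact (apply_mem_orderIso_iff h).2 (subset_closure hx)
  · rw [← f.le_symm_apply, closure_le]
    intro x hx
    rw [SetLike.mem_coe, ← apply_mem_orderIso_iff h, f.apply_symm_apply]
    exact subset_closure (Set.mem_image_of_mem φ hx)

theorem independent_image_iff (h : ∀ x, zpowers (φ x) = f (zpowers x)) (X : Set G₁) :
    Independent X ↔ Independent (φ '' X) := by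
  have h1 : ∀ x, φ x ∈ closure (φ '' X \ {φ x}) ↔ x ∈ closure (X \ {x}) := by
    intro x
    rw [← Set.image_singleton, ← Set.image_sdiff φ.injective, closure_image_eq h,
      apply_mem_orderIso_iff h]
  rw [Independent, Independent, Set.forall_mem_image]
  simp only [h1]

theorem dgen_orderIso [Finite G₁] (h : ∀ x, zpowers (φ x) = f (zpowers x)) (H : Subgroup G₁) :
    dgen (f H) = dgen H := by
  have : Finite G₂ := Finite.of_equiv _ φ
  unfold dgen
  congr 1
  ext n
  constructor
  · rintro ⟨S, -, -, hS, rfl⟩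
    refine ⟨φ ⁻¹' S, Set.toFinite _, ?_, ?_, ?_⟩
    · intro x hx
      rw [SetLike.mem_coe, ← apply_mem_orderIso_iff h, ← hS]
      exact subset_closure hx
    · apply f.injective
      rw [← closure_image_eq h, φ.surjective.image_preimage, hS]
    · rw [← Set.ncard_image_of_injective _ φ.injective, φ.surjective.image_preimage]
  · rintro ⟨S, -, -, hS, rfl⟩
    have h1 : closure (φ '' S) = f H := by rw [closure_image_eq h, hS]
    exact ⟨φ '' S, Set.toFinite _, h1 ▸ subset_closure, h1,
      Set.ncard_image_of_injective _ φ.injective⟩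

theorem stronglyIndependent_image_iff [Finite G₁] (h : ∀ x, zpowers (φ x) = f (zpowers x))
    (X : Set G₁) : StronglyIndependent X ↔ StronglyIndependent (φ '' X) := by
  have h1 : ∀ H : Subgroup G₁, φ '' X ⊆ (f H : Set G₂) ↔ X ⊆ (H : Set G₁) := by
    intro H
    rw [Set.image_subset_iff]
    exact forall₂_congr fun x _ => apply_mem_orderIso_iff h
  rw [StronglyIndependent, StronglyIndependent, f.surjective.forall]
  simp only [h1, dgen_orderIso h, Set.ncard_image_of_injective _ φ.injective]

end Transfer

section IndependentSets

variable {G : Type*} [Group G]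

theorem independent_singleton_iff (x : G) : Independent ({x} : Set G) ↔ x ≠ 1 := by
  simp [Independent]

theorem independent_pair_iff {x y : G} (h : x ≠ y) :
    Independent ({x, y} : Set G) ↔ ¬ PowerComparable x y := by
  have h1 : ({x, y} : Set G) \ {x} = {y} := by
    ext z; simp only [Set.mem_sdiff, Set.mem_insert_iff, Set.mem_singleton_iff]; grind
  have h2 : ({x, y} : Set G) \ {y} = {x} := by
    ext z; simp only [Set.mem_sdiff, Set.mem_insert_iff, Set.mem_singleton_iff]; grind
  simp [Independent, PowerComparable, h1, h2, ← zpowers_eq_closure]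

theorem exists_mem_closure_pair_of_not_independent {a b y : G}
    (h : ¬ Independent ({a, b, y} : Set G)) : ∃ u v,
      a ∈ closure ({u, v} : Set G) ∧ b ∈ closure ({u, v} : Set G) ∧
        y ∈ closure ({u, v} : Set G) := by
  have hm : ∀ {s t : G}, s ∈ closure ({s, t} : Set G) ∧ t ∈ closure ({s, t} : Set G) :=
    ⟨subset_closure (by simp), subset_closure (by simp)⟩
  simp only [Independent, not_forall, not_not] at h
  obtain ⟨x, hx, hxc⟩ := h
  have hs : ∀ s t : G, ({a, b, y} : Set G) \ {x} ⊆ {s, t} → x ∈ closure ({s, t} : Set G) :=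
    fun s t hst => closure_mono hst hxc
  rcases hx with rfl | rfl | rfl
  · exact ⟨b, y, hs b y (by rintro z ⟨h1, h2⟩; simp_all), hm.1, hm.2⟩
  · exact ⟨a, y, hm.1, hs a y (by
      rintro z ⟨h1, h2⟩
      simp only [Set.mem_insert_iff, Set.mem_singleton_iff] at *
      tauto), hm.2⟩
  · exact ⟨a, b, hm.1, hm.2, hs a b (by
      rintro z ⟨h1, h2⟩
      simp only [Set.mem_insert_iff, Set.mem_singleton_iff] at *
      tauto)⟩

theorem not_independent_of_mem_closure_pair {a b y : G} (hya : y ≠ a) (hyb : y ≠ b)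
    (h : y ∈ closure ({a, b} : Set G)) : ¬ Independent ({a, b, y} : Set G) := by
  intro hi
  refine hi y (by simp) ?_
  have h1 : ({a, b, y} : Set G) \ {y} = {a, b} := by
    ext z; simp only [Set.mem_sdiff, Set.mem_insert_iff, Set.mem_singleton_iff]; grind
  rwa [h1]

variable [Finite G]

theorem exists_closure_eq_ncard_eq_dgen (H : Subgroup G) :
    ∃ S : Set G, closure S = H ∧ S.ncard = dgen H := by
  obtain ⟨S, -, -, h1, h2⟩ := Nat.sInf_mem (s := {n : ℕ | ∃ S : Set G, S.Finite ∧
    S ⊆ (H : Set G) ∧ Subgroup.closure S = H ∧ S.ncard = n})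
    ⟨_, H, Set.toFinite _, subset_rfl, closure_eq H, rfl⟩
  exact ⟨S, h1, h2⟩

theorem dgen_closure_le (S : Set G) : dgen (closure S) ≤ S.ncard :=
  Nat.sInf_le ⟨S, Set.toFinite _, subset_closure, rfl, rfl⟩

theorem exists_zpowers_eq_of_dgen_le_one {H : Subgroup G} (h : dgen H ≤ 1) :
    ∃ g, zpowers g = H := by
  obtain ⟨S, rfl, hS⟩ := exists_closure_eq_ncard_eq_dgen H
  rw [← hS, Set.ncard_le_one_iff_subsingleton] at h
  rcases h.eq_empty_or_singleton with rfl | ⟨g, rfl⟩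
  · exact ⟨1, by simp⟩
  · exact ⟨g, zpowers_eq_closure g⟩

theorem exists_closure_pair_eq_of_dgen_le_two {H : Subgroup G} (h : dgen H ≤ 2) :
    ∃ u v, closure ({u, v} : Set G) = H := by
  obtain ⟨S, hSH, hS⟩ := exists_closure_eq_ncard_eq_dgen H
  rcases h.lt_or_eq with h1 | h1
  · obtain ⟨g, rfl⟩ := exists_zpowers_eq_of_dgen_le_one (Nat.le_of_lt_succ h1)
    exact ⟨g, g, by simp [zpowers_eq_closure]⟩
  · rw [h1] at hS
    obtain ⟨u, v, -, rfl⟩ := Set.ncard_eq_two.1 hS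
    exact ⟨u, v, hSH⟩

theorem stronglyIndependent_singleton_iff (x : G) :
    StronglyIndependent ({x} : Set G) ↔ x ≠ 1 := by
  constructor
  · rintro h rfl
    have h1 := h ⊥ (by simp)
    have h2 := dgen_closure_le (∅ : Set G)
    rw [Subgroup.closure_empty, Set.ncard_empty] at h2
    rw [Set.ncard_singleton] at h1
    omega
  · intro hx H hH
    rw [Set.ncard_singleton]
    by_contra! h
    obtain ⟨S, rfl, hS⟩ := exists_closure_eq_ncard_eq_dgen H
    rw [show S = ∅ from (Set.ncard_eq_zero).1 (by omega)] at hH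
    simp at hH
    exact hx hH

theorem stronglyIndependent_pair_iff {p : ℕ} [Fact p.Prime] (hG : IsPGroup p G) {x y : G}
    (h : x ≠ y) : StronglyIndependent ({x, y} : Set G) ↔ ¬ PowerComparable x y := by
  have hz : ∀ g : G, dgen (zpowers g) ≤ 1 := by
    intro g
    rw [zpowers_eq_closure]
    exact (dgen_closure_le _).trans (Set.ncard_singleton g).le
  constructor
  · rintro hs (h1 | h1)
    · have h2 := hs (zpowers y) (by rintro z (rfl | rfl); exacts [h1, mem_zpowers z])
      have := hz y
      rw [Set.ncard_pair h] at h2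
      omega
    · have h2 := hs (zpowers x) (by rintro z (rfl | rfl); exacts [mem_zpowers z, h1])
      have := hz x
      rw [Set.ncard_pair h] at h2
      omega
  · intro hc H hH
    rw [Set.ncard_pair h]
    by_contra! h1
    obtain ⟨g, rfl⟩ := exists_zpowers_eq_of_dgen_le_one (Nat.le_of_lt_succ h1)
    exact hc (powerComparable_of_mem_zpowers hG (hH (by simp)) (hH (by simp)))

theorem exists_mem_closure_pair_of_not_stronglyIndependent {a b y : G}
    (h : ¬ StronglyIndependent ({a, b, y} : Set G)) : ∃ u v,
      a ∈ closure ({u, v} : Set G) ∧ b ∈ closure ({u, v} : Set G) ∧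
        y ∈ closure ({u, v} : Set G) := by
  simp only [StronglyIndependent, not_forall, not_le] at h
  obtain ⟨H, hH, hlt⟩ := h
  have h3 : Set.ncard ({a, b, y} : Set G) ≤ 3 := by
    have h1 := Set.ncard_insert_le a ({b, y} : Set G)
    have h2 := Set.ncard_insert_le b ({y} : Set G)
    rw [Set.ncard_singleton] at h2
    omega
  obtain ⟨u, v, rfl⟩ := exists_closure_pair_eq_of_dgen_le_two (H := H) (by omega)
  exact ⟨u, v, hH (by simp), hH (by simp), hH (by simp)⟩

theorem not_stronglyIndependent_of_mem_closure_pair {a b y : G} (hab : a ≠ b) (hya : y ≠ a)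
    (hyb : y ≠ b) (h : y ∈ closure ({a, b} : Set G)) :
    ¬ StronglyIndependent ({a, b, y} : Set G) := by
  intro hs
  have h1 := hs (closure {a, b}) (by
    rintro z (rfl | rfl | rfl)
    exacts [subset_closure (by simp), subset_closure (by simp), h])
  have h2 := dgen_closure_le ({a, b} : Set G)
  rw [Set.ncard_pair hab] at h2
  rw [Set.ncard_eq_three.2 ⟨a, b, y, hab, hya.symm, hyb.symm, rfl⟩] at h1
  omega

end IndependentSets

/-- A bijection preserving a family of sets that detects the identity, power comparability and
containment in two-generated subgroups yields an isomorphism of subgroup lattices. -/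
theorem nonempty_subgroup_orderIso_of_family {p : ℕ} [Fact p.Prime]
    {G₁ G₂ : Type*} [CommGroup G₁] [Finite G₁] [Group G₂] [Finite G₂]
    (hG₁ : IsPGroup p G₁) (hG₂ : IsPGroup p G₂) (φ : G₁ ≃ G₂)
    {P : Set G₁ → Prop} {Q : Set G₂ → Prop} (hPQ : ∀ X, P X ↔ Q (φ '' X))
    (hP₁ : ∀ x, P {x} ↔ x ≠ 1) (hQ₁ : ∀ x, Q {x} ↔ x ≠ 1)
    (hP₂ : ∀ x y, x ≠ y → (P {x, y} ↔ ¬ PowerComparable x y))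
    (hQ₂ : ∀ x y, x ≠ y → (Q {x, y} ↔ ¬ PowerComparable x y))
    (hP₃ : ∀ a b y, ¬ P {a, b, y} → ∃ u v, a ∈ closure ({u, v} : Set G₁) ∧
      b ∈ closure ({u, v} : Set G₁) ∧ y ∈ closure ({u, v} : Set G₁))
    (hQ₃ : ∀ a b y, a ≠ b → y ≠ a → y ≠ b → y ∈ closure ({a, b} : Set G₂) → ¬ Q {a, b, y}) :
    Nonempty (Subgroup G₁ ≃o Subgroup G₂) := by
  refine nonempty_subgroup_orderIso hG₁ hG₂ φ ?_ ?_ ?_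
  · have h := hPQ {1}
    rw [Set.image_singleton, hP₁, hQ₁] at h
    simpa using h
  · intro x y
    by_cases hxy : x = y
    · subst hxy
      simp [PowerComparable.refl]
    have h := hPQ {x, y}
    rw [Set.image_pair, hP₂ _ _ hxy, hQ₂ _ _ (φ.injective.ne hxy)] at h
    exact not_iff_not.1 h
  · intro a b y hy
    have hm : ∀ {s t : G₁}, s ∈ closure ({s, t} : Set G₁) ∧ t ∈ closure ({s, t} : Set G₁) :=
      ⟨subset_closure (by simp), subset_closure (by simp)⟩
    by_cases hab : a = b
    · subst hab
      exact ⟨a, y, hm.1, hm.1, hm.2⟩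
    by_cases hya : y = a
    · subst hya
      exact ⟨y, b, hm.1, hm.2, hm.1⟩
    by_cases hyb : y = b
    · subst hyb
      exact ⟨a, y, hm.1, hm.2, hm.2⟩
    apply hP₃
    rw [hPQ, Set.image_insert_eq, Set.image_pair]
    exact hQ₃ _ _ _ (φ.injective.ne hab) (φ.injective.ne hya) (φ.injective.ne hyb) hy

end PGroupPower

theorem abelian_pGroup_indep_iff_strong_iff_lattice
    (p : ℕ) (hp : p.Prime) (G₁ G₂ : Type) [CommGroup G₁] [Finite G₁] [Group G₂] [Finite G₂]
    (hG₁ : IsPGroup p G₁) (hG₂ : IsPGroup p G₂) :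
    List.TFAE
      [ ∃ φ : G₁ ≃ G₂, ∀ X : Set G₁, Independent X ↔ Independent (φ '' X),
        ∃ φ : G₁ ≃ G₂, ∀ X : Set G₁, StronglyIndependent X ↔ StronglyIndependent (φ '' X),
        Nonempty (Subgroup G₁ ≃o Subgroup G₂) ] := by
  have : Fact p.Prime := ⟨hp⟩
  tfae_have 1 → 3 := by
    rintro ⟨φ, hφ⟩
    exact PGroupPower.nonempty_subgroup_orderIso_of_family hG₁ hG₂ φ hφ
      PGroupPower.independent_singleton_iff PGroupPower.independent_singleton_iff
      (fun _ _ => PGroupPower.independent_pair_iff) (fun _ _ => PGroupPower.independent_pair_iff)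
      (fun _ _ _ => PGroupPower.exists_mem_closure_pair_of_not_independent)
      (fun _ _ _ _ => PGroupPower.not_independent_of_mem_closure_pair)
  tfae_have 2 → 3 := by
    rintro ⟨φ, hφ⟩
    exact PGroupPower.nonempty_subgroup_orderIso_of_family hG₁ hG₂ φ hφ
      PGroupPower.stronglyIndependent_singleton_iff PGroupPower.stronglyIndependent_singleton_iff
      (fun _ _ => PGroupPower.stronglyIndependent_pair_iff hG₁)
      (fun _ _ => PGroupPower.stronglyIndependent_pair_iff hG₂)
      (fun _ _ _ => PGroupPower.exists_mem_closure_pair_of_not_stronglyIndependent)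
      (fun _ _ _ => PGroupPower.not_stronglyIndependent_of_mem_closure_pair)
  tfae_have 3 → 1 := by
    rintro ⟨f⟩
    obtain ⟨φ, hφ⟩ := PGroupPower.exists_equiv_of_orderIso hG₁ hG₂ f
    exact ⟨φ, PGroupPower.independent_image_iff hφ⟩
  tfae_have 3 → 2 := by
    rintro ⟨f⟩
    obtain ⟨φ, hφ⟩ := PGroupPower.exists_equiv_of_orderIso hG₁ hG₂ f
    exact ⟨φ, PGroupPower.stronglyIndependent_image_iff hφ⟩
  tfae_finish
end
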